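/- Consider the BDAR(p) Markov kernel κ. Suppose μ is a probability measure on ℝ with mean 0 and variance 1 that admits a density f with respect to Lebesgue measure which is positive on all of ℝ, locally bounded away from 0, and satisfies sup_{x∈ℝ}(1+|x|)f(x) < ∞. Then κ is geometrically ergodic (in particular an invariant probability measure π exists) provided one of the following conditions holds: (i) there is r ∈ (0,1] with m_r < ∞ and Σ_{j=1}^p (b_j^r + a_j^{r/2} m_r) < 1; (ii) there is r ∈ (1,2] with m_r < ∞, f symmetric (f(x)=f(−x)), and (Σ_{j=1}^p b_j)^r + (Σ_{j=1}^p a_j^{r/2}) m_r < 1; (iii) ∫x³ dμ = 0, m₄ < ∞, and (1+3m₂)(Σ_{j=1}^p b_j)^4 + (m₄+3m₂)(Σ_{j=1}^p a_j)² < 1. -/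

import Mathlib

open MeasureTheory
open scoped ENNReal

noncomputable section

/-- One step of the BDAR(p) recursion on the state space `(Fin p → ℝ) × Bool`
(lag vector and regime indicator, regime 1 ↔ `true`). Given the current state `s` and
innovation `ε`, the new regime `R'` is `true` if `y d ≤ rL`, `false` if `y d > rU`, and
`s.2` otherwise; the new observation is generated from the coefficients of the active
regime (regime 1 coefficients indexed by `0`, regime 2 by `1`). -/
def bdarStep (p : ℕ) (d : Fin p) (rL rU : ℝ)
    (φ0 : Fin 2 → ℝ) (φ : Fin 2 → Fin p → ℝ)
    (α0 : Fin 2 → ℝ) (α : Fin 2 → Fin p → ℝ)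
    (s : (Fin p → ℝ) × Bool) (ε : ℝ) : (Fin p → ℝ) × Bool :=
  let y := s.1
  let R' : Bool := if y d ≤ rL then true else if rU < y d then false else s.2
  let i : Fin 2 := if R' then 0 else 1
  (fun k =>
    if _ : (k : ℕ) = 0 then
      φ0 i + (∑ j, φ i j * y j) + ε * Real.sqrt (α0 i + ∑ j, α i j * y j ^ 2)
    else y ⟨(k : ℕ) - 1, by have := k.isLt; omega⟩, R')

/-- The `n`-step transition measures of a transition function `κ`. -/
def iterKernel {S : Type*} [MeasurableSpace S] (κ : S → Measure S) : ℕ → S → Measure S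
  | 0 => fun s => Measure.dirac s
  | n + 1 => fun s => (iterKernel κ n s).bind κ

section Iterates

variable {S : Type*} [MeasurableSpace S] {κ : S → Measure S}

lemma measurable_iterKernel (hκ : Measurable κ) : ∀ n, Measurable (iterKernel κ n)
  | 0 => Measure.measurable_dirac
  | n + 1 => (Measure.measurable_bind' hκ).comp (measurable_iterKernel hκ n)

lemma iterKernel_add (hκ : Measurable κ) (m n : ℕ) (s : S) :
    iterKernel κ (m + n) s = (iterKernel κ m s).bind (iterKernel κ n) := by
  induction n with
  | zero => exact (Measure.bind_dirac (m := iterKernel κ m s)).symm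
  | succ n ih =>
    change (iterKernel κ (m + n) s).bind κ = _
    rw [ih, Measure.bind_bind (measurable_iterKernel hκ n).aemeasurable hκ.aemeasurable]
    rfl

lemma iterKernel_one (hκ : Measurable κ) : iterKernel κ 1 = κ :=
  funext fun s => Measure.dirac_bind hκ s

lemma isProbabilityMeasure_iterKernel (hκ : Measurable κ)
    (hprob : ∀ s, IsProbabilityMeasure (κ s)) (n : ℕ) (s : S) :
    IsProbabilityMeasure (iterKernel κ n s) := by
  induction n with
  | zero => exact Measure.dirac.isProbabilityMeasure
  | succ n ih =>
    exact ⟨by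
      change (iterKernel κ n s).bind κ Set.univ = 1
      rw [Measure.bind_apply MeasurableSet.univ hκ.aemeasurable]
      simp⟩

/-- A one-step geometric drift inequality propagates to all iterates. -/
lemma lintegral_iterKernel_le (hκ : Measurable κ) (hprob : ∀ s, IsProbabilityMeasure (κ s))
    {V : S → ℝ} (hV : Measurable V) (hV0 : ∀ s, 0 ≤ V s) {γ K : ℝ} (hγ0 : 0 ≤ γ) (hγ1 : γ < 1)
    (hK : 0 ≤ K)
    (hdrift : ∀ s, ∫⁻ x, ENNReal.ofReal (V x) ∂κ s ≤ ENNReal.ofReal (γ * V s + K))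
    (n : ℕ) (s : S) :
    ∫⁻ x, ENNReal.ofReal (V x) ∂iterKernel κ n s
      ≤ ENNReal.ofReal (γ ^ n * V s + K / (1 - γ)) := by
  have h1 : 0 < 1 - γ := by linarith
  induction n with
  | zero =>
    change ∫⁻ x, ENNReal.ofReal (V x) ∂Measure.dirac s ≤ _
    rw [lintegral_dirac' _ hV.ennreal_ofReal]
    apply ENNReal.ofReal_le_ofReal
    have : 0 ≤ K / (1 - γ) := by positivity
    simpa using this
  | succ n ih =>
    have := isProbabilityMeasure_iterKernel hκ hprob n s
    change ∫⁻ x, ENNReal.ofReal (V x) ∂((iterKernel κ n s).bind κ) ≤ _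
    rw [Measure.lintegral_bind hκ.aemeasurable hV.ennreal_ofReal.aemeasurable]
    calc ∫⁻ x, ∫⁻ y, ENNReal.ofReal (V y) ∂κ x ∂iterKernel κ n s
        ≤ ∫⁻ x, (ENNReal.ofReal γ * ENNReal.ofReal (V x) + ENNReal.ofReal K)
            ∂iterKernel κ n s := by
          refine lintegral_mono fun x => (hdrift x).trans ?_
          rw [ENNReal.ofReal_add (mul_nonneg hγ0 (hV0 x)) hK, ENNReal.ofReal_mul hγ0]
      _ = ENNReal.ofReal γ * ∫⁻ x, ENNReal.ofReal (V x) ∂iterKernel κ n s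
            + ENNReal.ofReal K := by
          rw [lintegral_add_right _ measurable_const, lintegral_const_mul _ hV.ennreal_ofReal]
          simp
      _ ≤ ENNReal.ofReal γ * ENNReal.ofReal (γ ^ n * V s + K / (1 - γ))
            + ENNReal.ofReal K := by gcongr
      _ = ENNReal.ofReal (γ ^ (n + 1) * V s + K / (1 - γ)) := by
          have := hV0 s
          rw [← ENNReal.ofReal_mul hγ0, ← ENNReal.ofReal_add (by positivity) hK]
          congr 1
          field_simp
          ring

lemma integrable_of_lintegral_ofReal_le {ν : Measure S} {V : S → ℝ} (hV : Measurable V)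
    (hV0 : ∀ s, 0 ≤ V s) {c : ℝ} (h : ∫⁻ x, ENNReal.ofReal (V x) ∂ν ≤ ENNReal.ofReal c) :
    Integrable V ν := by
  refine ⟨hV.aestronglyMeasurable, ?_⟩
  rw [hasFiniteIntegral_iff_ofReal (Filter.Eventually.of_forall hV0)]
  exact h.trans_lt ENNReal.ofReal_lt_top

lemma integral_le_of_lintegral_ofReal_le {ν : Measure S} {V : S → ℝ} (hV : Measurable V)
    (hV0 : ∀ s, 0 ≤ V s) {c : ℝ} (hc : 0 ≤ c)
    (h : ∫⁻ x, ENNReal.ofReal (V x) ∂ν ≤ ENNReal.ofReal c) :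
    ∫ x, V x ∂ν ≤ c := by
  rw [integral_eq_lintegral_of_nonneg_ae (Filter.Eventually.of_forall hV0)
    hV.aestronglyMeasurable]
  exact ENNReal.toReal_le_of_le_ofReal hc h

end Iterates

section Harris

/-- A function whose oscillation is controlled by `W x + W y` is within `W` of a constant. -/
lemma exists_const_abs_sub_le {S : Type*} {g W : S → ℝ} (h : ∀ x y, g x - g y ≤ W x + W y) :
    ∃ c, ∀ x, |g x - c| ≤ W x := by
  rcases isEmpty_or_nonempty S with hS | ⟨⟨y₀⟩⟩
  · exact ⟨0, fun x => (hS.false x).elim⟩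
  have hbdd : BddAbove (Set.range fun x => g x - W x) :=
    ⟨g y₀ + W y₀, by rintro _ ⟨x, rfl⟩; have := h x y₀; dsimp only; linarith⟩
  have : Nonempty S := ⟨y₀⟩
  refine ⟨⨆ x, (g x - W x), fun x => abs_le.2 ⟨?_, ?_⟩⟩
  · have : ⨆ z, (g z - W z) ≤ g x + W x := ciSup_le fun z => by have := h z x; linarith
    linarith
  · have := le_ciSup hbdd x
    linarith

variable {S : Type*} [MeasurableSpace S]

/-- Under a drift condition and a minorization on a sublevel set of the Lyapunov function, a
Markov kernel contracts a weighted oscillation seminorm. -/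
lemma exists_weighted_oscillation_contraction {P : S → Measure S}
    (hP : ∀ s, IsProbabilityMeasure (P s)) {V : S → ℝ} (hV0 : ∀ s, 0 ≤ V s)
    (hInt : ∀ s, Integrable V (P s)) {γ K : ℝ} (hγ0 : 0 ≤ γ) (hγ1 : γ < 1) (hK : 0 < K)
    (hdrift : ∀ s, ∫ x, V x ∂P s ≤ γ * V s + K)
    (hmin : ∃ α : ℝ, 0 < α ∧ ∃ ν : Measure S, IsProbabilityMeasure ν ∧
      ∀ s, V s ≤ 4 * K / (1 - γ) → ENNReal.ofReal α • ν ≤ P s) :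
    ∃ β : ℝ, 0 < β ∧ ∃ ρ ∈ Set.Ioo (0 : ℝ) 1, ∀ g : S → ℝ, Measurable g →
      (∃ B, ∀ s, |g s| ≤ B) → ∀ M, 0 ≤ M →
      (∀ x y, g x - g y ≤ M * (1 + β * V x) + M * (1 + β * V y)) →
      ∀ x y, ∫ z, g z ∂P x - ∫ z, g z ∂P y
        ≤ (ρ * M) * (1 + β * V x) + (ρ * M) * (1 + β * V y) := by
  obtain ⟨α, hα, ν, hν, hle⟩ := hmin
  have h1γ : 0 < 1 - γ := by linarith
  set R := 4 * K / (1 - γ) with hR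
  have hRpos : 0 < R := by positivity
  have hRK : (1 - γ) * R = 4 * K := by rw [hR]; field_simp
  obtain ⟨β, hβpos, hβK⟩ : ∃ β : ℝ, 0 < β ∧ β * (2 * K) = α :=
    ⟨α / (2 * K), by positivity, by field_simp⟩
  set τ := (2 + β * ((1 + γ) / 2) * R) / (2 + β * R) with hτ
  have hden : 0 < 2 + β * R := by positivity
  have hτ1 : τ < 1 := by
    rw [hτ, div_lt_one hden]
    nlinarith [mul_pos hβpos hRpos]
  have hτ0 : 0 < τ := by positivity
  set ρ := max τ (max γ (1 - α / 2)) with hρ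
  have hρτ : τ ≤ ρ := le_max_left _ _
  have hργ : γ ≤ ρ := (le_max_left _ _).trans (le_max_right _ _)
  have hρα : 1 - α / 2 ≤ ρ := (le_max_right _ _).trans (le_max_right _ _)
  have hρ0 : 0 < ρ := hτ0.trans_le hρτ
  have hρ1 : ρ < 1 := max_lt hτ1 (max_lt hγ1 (by linarith))
  refine ⟨β, hβpos, ρ, ⟨hρ0, hρ1⟩, ?_⟩
  rintro g hg ⟨B, hB⟩ M hM hosc x y
  obtain ⟨c, hc⟩ := exists_const_abs_sub_le (W := fun x => M * (1 + β * V x)) hosc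
  have hgi : ∀ s, Integrable g (P s) := fun s =>
    Integrable.of_bound hg.aestronglyMeasurable B (Filter.Eventually.of_forall hB)
  have hWi : ∀ s, Integrable (fun z => M * (1 + β * V z)) (P s) := fun s =>
    ((integrable_const 1).add ((hInt s).const_mul β)).const_mul M
  have hWint : ∀ s, ∫ z, M * (1 + β * V z) ∂P s = M * (1 + β * ∫ z, V z ∂P s) := by
    intro s
    rw [integral_const_mul, integral_add (integrable_const _) ((hInt s).const_mul β),
      integral_const_mul]
    simp
  have hgci : ∀ s, Integrable (fun z => g z - c) (P s) := fun s =>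
    (hgi s).sub (integrable_const c)
  have hgcint : ∀ s, ∫ z, (g z - c) ∂P s = ∫ z, g z ∂P s - c := by
    intro s
    rw [integral_sub (hgi s) (integrable_const _)]
    simp
  have hu : 0 ≤ V x + V y := add_nonneg (hV0 x) (hV0 y)
  have hdx := hdrift x
  have hdy := hdrift y
  rcases le_total R (V x + V y) with hRu | hRu
  · have hux : ∫ z, (g z - c) ∂P x ≤ ∫ z, M * (1 + β * V z) ∂P x :=
      integral_mono (hgci x) (hWi x) fun z => (abs_le.1 (hc z)).2
    have huy : -∫ z, M * (1 + β * V z) ∂P y ≤ ∫ z, (g z - c) ∂P y := by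
      rw [← integral_neg]
      exact integral_mono (hWi y).neg (hgci y)
        fun z => (abs_le.1 (hc z)).1
    rw [hgcint, hWint] at hux huy
    have key : 2 + β * ((1 + γ) / 2) * (V x + V y) ≤ ρ * (2 + β * (V x + V y)) := by
      have h1 : 2 + β * ((1 + γ) / 2) * (V x + V y) ≤ τ * (2 + β * (V x + V y)) := by
        rw [hτ, div_mul_eq_mul_div, le_div_iff₀ hden]
        nlinarith [mul_nonneg (mul_nonneg hβpos.le h1γ.le) (sub_nonneg.2 hRu)]
      have h2 : 0 ≤ 2 + β * (V x + V y) := by positivity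
      nlinarith
    have hsum : ∫ z, V z ∂P x + ∫ z, V z ∂P y ≤ (1 + γ) / 2 * (V x + V y) := by
      nlinarith
    have h3 : 2 + β * (∫ z, V z ∂P x + ∫ z, V z ∂P y) ≤ ρ * (2 + β * (V x + V y)) :=
      le_trans (by nlinarith) key
    have h4 := mul_le_mul_of_nonneg_left h3 hM
    linarith
  · have hlex := hle x (by linarith [hV0 y])
    have hley := hle y (by linarith [hV0 x])
    have hα0 : ENNReal.ofReal α ≠ 0 := by simpa using hα
    have hVν : Integrable V ν :=
      (integrable_smul_measure hα0 ENNReal.ofReal_ne_top).1 ((hInt x).mono_measure hlex)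
    have hgν : Integrable g ν :=
      Integrable.of_bound hg.aestronglyMeasurable B (Filter.Eventually.of_forall hB)
    have hgcν : Integrable (fun z => g z - c) ν := hgν.sub (integrable_const c)
    have hWν : Integrable (fun z => M * (1 + β * V z)) ν :=
      ((integrable_const 1).add (hVν.const_mul β)).const_mul M
    have hux : α * ∫ z, (M * (1 + β * V z) - (g z - c)) ∂ν
        ≤ ∫ z, (M * (1 + β * V z) - (g z - c)) ∂P x := by
      have := integral_mono_measure hlex
        (Filter.Eventually.of_forall fun z => sub_nonneg.2 (abs_le.1 (hc z)).2)
        ((hWi x).sub (hgci x))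
      rwa [integral_smul_measure, ENNReal.toReal_ofReal hα.le, smul_eq_mul] at this
    have huy : α * ∫ z, (M * (1 + β * V z) + (g z - c)) ∂ν
        ≤ ∫ z, (M * (1 + β * V z) + (g z - c)) ∂P y := by
      have := integral_mono_measure hley
        (f := fun z => M * (1 + β * V z) + (g z - c))
        (Filter.Eventually.of_forall fun z => by
          have := (abs_le.1 (hc z)).1
          simp only [Pi.zero_apply]
          linarith)
        ((hWi y).add (hgci y))
      rwa [integral_smul_measure, ENNReal.toReal_ofReal hα.le, smul_eq_mul] at this
    rw [integral_sub hWν hgcν,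
      integral_sub (hWi x) (hgci x), hgcint, hWint] at hux
    rw [integral_add hWν hgcν,
      integral_add (hWi y) (hgci y), hgcint, hWint] at huy
    have hνW : M ≤ ∫ z, M * (1 + β * V z) ∂ν := by
      calc M = ∫ _, M ∂ν := by simp
        _ ≤ _ := integral_mono (integrable_const _) hWν fun z => by
          have := mul_nonneg hβpos.le (hV0 z)
          dsimp only
          nlinarith
    have h3 : 2 + β * (∫ z, V z ∂P x + ∫ z, V z ∂P y) - 2 * α ≤ ρ * (2 + β * (V x + V y)) := by
      have : β * (∫ z, V z ∂P x + ∫ z, V z ∂P y) ≤ β * (γ * (V x + V y) + 2 * K) :=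
        mul_le_mul_of_nonneg_left (by linarith) hβpos.le
      have : γ * (β * (V x + V y)) ≤ ρ * (β * (V x + V y)) :=
        mul_le_mul_of_nonneg_right hργ (by positivity)
      nlinarith
    have h4 := mul_le_mul_of_nonneg_left h3 hM
    have h5 := mul_le_mul_of_nonneg_left hνW hα.le
    linarith

end Harris

section SetwiseLimits

open Filter Topology

variable {S : Type*} [MeasurableSpace S]

/-- A sequence of probability measures that is Cauchy uniformly over measurable sets converges
uniformly over measurable sets to a probability measure. -/
lemma exists_probabilityMeasure_abs_sub_le {ν : ℕ → Measure S}
    (hν : ∀ m, IsProbabilityMeasure (ν m)) {ε : ℕ → ℝ} (hε : Tendsto ε atTop (𝓝 0))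
    (h : ∀ m k A, MeasurableSet A → |(ν (m + k)).real A - (ν m).real A| ≤ ε m) :
    ∃ π : Measure S, IsProbabilityMeasure π ∧
      ∀ m A, MeasurableSet A → |(ν m).real A - π.real A| ≤ ε m := by
  have hlim : ∀ A, ∃ l, MeasurableSet A → Tendsto (fun m => (ν m).real A) atTop (𝓝 l) := by
    intro A
    by_cases hA : MeasurableSet A
    · have hc : CauchySeq fun m => (ν m).real A := by
        refine cauchySeq_of_le_tendsto_0' ε (fun n m hnm => ?_) hε
        obtain ⟨k, rfl⟩ := Nat.exists_eq_add_of_le hnm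
        rw [dist_comm, Real.dist_eq]
        exact h n k A hA
      obtain ⟨l, hl⟩ := cauchySeq_tendsto_of_complete hc
      exact ⟨l, fun _ => hl⟩
    · exact ⟨0, fun h => (hA h).elim⟩
  choose L hL using hlim
  have hclose : ∀ m A, MeasurableSet A → |(ν m).real A - L A| ≤ ε m := by
    intro m A hA
    have h1 : Tendsto (fun k => |(ν (m + k)).real A - (ν m).real A|) atTop
        (𝓝 |L A - (ν m).real A|) :=
      (((hL A hA).comp (tendsto_add_atTop_nat m)).sub_const _).abs.congr fun k => by
        simp [add_comm]
    rw [abs_sub_comm]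
    exact le_of_tendsto' h1 fun k => h m k A hA
  have hL0 : ∀ A, MeasurableSet A → 0 ≤ L A := fun A hA =>
    ge_of_tendsto' (hL A hA) fun m => measureReal_nonneg
  have hsum : ∀ f : ℕ → Set S, (∀ i, MeasurableSet (f i)) → Pairwise (Function.onFun Disjoint f) →
      HasSum (fun i => L (f i)) (L (⋃ i, f i)) := by
    intro f hf hd
    have hU := MeasurableSet.iUnion hf
    have hfin : ∀ t : Finset ℕ, ∑ i ∈ t, L (f i) = L (⋃ i ∈ t, f i) := by
      intro t
      refine tendsto_nhds_unique (tendsto_finsetSum t fun i _ => hL (f i) (hf i))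
        ((hL _ (t.measurableSet_biUnion fun i _ => hf i)).congr fun m => ?_)
      exact measureReal_biUnion_finset (fun i _ j _ hij => hd hij) fun i _ => hf i
    have hνsum : ∀ m, Tendsto (fun t : Finset ℕ => (ν m).real (⋃ i ∈ t, f i)) atTop
        (𝓝 ((ν m).real (⋃ i, f i))) := by
      intro m
      have h1 : HasSum (fun i => ν m (f i)) (ν m (⋃ i, f i)) := by
        rw [measure_iUnion hd hf]
        exact ENNReal.summable.hasSum
      refine ((ENNReal.tendsto_toReal (measure_ne_top _ _)).comp h1).congr fun t => ?_
      rw [measureReal_def, measure_biUnion_finset (fun i _ j _ hij => hd hij) fun i _ => hf i]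
      rfl
    refine Metric.tendsto_atTop.2 fun e he => ?_
    obtain ⟨m, hm⟩ := (hε.eventually (gt_mem_nhds (show 0 < e / 3 by positivity))).exists
    obtain ⟨t₀, ht₀⟩ := (Metric.tendsto_atTop.1 (hνsum m)) (e / 3) (by positivity)
    refine ⟨t₀, fun t ht => ?_⟩
    have h1 := ht₀ t ht
    have h2 := hclose m (⋃ i ∈ t, f i) (t.measurableSet_biUnion fun i _ => hf i)
    have h3 := hclose m (⋃ i, f i) hU
    rw [hfin, Real.dist_eq]
    rw [Real.dist_eq] at h1
    rw [abs_le] at h2 h3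
    rw [abs_lt] at h1 ⊢
    constructor <;> linarith [h1.1, h1.2, h2.1, h2.2, h3.1, h3.2]
  let π : Measure S := Measure.ofMeasurable (fun A _ => ENNReal.ofReal (L A))
    (by
      have : L ∅ = 0 := tendsto_nhds_unique (hL ∅ MeasurableSet.empty) (by simp)
      simp [this])
    (fun f hf hd => by
      rw [← (hsum f hf hd).tsum_eq, ENNReal.ofReal_tsum_of_nonneg (fun i => hL0 _ (hf i))
        (hsum f hf hd).summable])
  have hπ : ∀ A, MeasurableSet A → π A = ENNReal.ofReal (L A) := fun A hA =>
    Measure.ofMeasurable_apply A hA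
  refine ⟨π, ⟨?_⟩, fun m A hA => ?_⟩
  · have : L Set.univ = 1 :=
      tendsto_nhds_unique (hL Set.univ MeasurableSet.univ) (by simp)
    rw [hπ _ MeasurableSet.univ, this, ENNReal.ofReal_one]
  · rw [measureReal_def π, hπ A hA, ENNReal.toReal_ofReal (hL0 A hA)]
    exact hclose m A hA

/-- If the iterates of a Markov kernel started at a point converge setwise to `π`, then `π` is
invariant. -/
lemma bind_eq_self_of_tendsto {κ : S → Measure S} (hκ : Measurable κ)
    (hprob : ∀ s, IsProbabilityMeasure (κ s)) {π : Measure S} [IsProbabilityMeasure π] {s : S}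
    (h : ∀ A, MeasurableSet A → Tendsto (fun m => iterKernel κ m s A) atTop (𝓝 (π A))) :
    π.bind κ = π := by
  have : IsProbabilityMeasure (π.bind κ) :=
    ⟨by rw [Measure.bind_apply MeasurableSet.univ hκ.aemeasurable]; simp⟩
  refine Measure.eq_of_le_of_isProbabilityMeasure (Measure.le_iff.2 fun A hA => ?_)
  rw [Measure.bind_apply hA hκ.aemeasurable, lintegral]
  refine iSup₂_le fun φ hφ => ?_
  have h1 : Tendsto (fun m => φ.lintegral (iterKernel κ m s)) atTop (𝓝 (φ.lintegral π)) := by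
    refine tendsto_finsetSum _ fun y hy => ENNReal.Tendsto.const_mul
      (h _ (φ.measurableSet_fiber y)) (Or.inr ?_)
    obtain ⟨x, rfl⟩ := SimpleFunc.mem_range.1 hy
    exact ((hφ x).trans_lt (measure_lt_top (κ x) A)).ne
  have h2 : Tendsto (fun m => iterKernel κ (m + 1) s A) atTop (𝓝 (π A)) :=
    (h A hA).comp (tendsto_add_atTop_nat 1)
  refine le_of_tendsto_of_tendsto' h1 h2 fun m => ?_
  change _ ≤ (iterKernel κ m s).bind κ A
  rw [Measure.bind_apply hA hκ.aemeasurable, ← SimpleFunc.lintegral_eq_lintegral]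
  exact lintegral_mono hφ

end SetwiseLimits

section HarrisTheorem

open Filter Topology

variable {S : Type*} [MeasurableSpace S] {κ : S → Measure S}

lemma measurable_iterKernel_real (hκ : Measurable κ) (m : ℕ) {A : Set S}
    (hA : MeasurableSet A) : Measurable fun s => (iterKernel κ m s).real A :=
  ((Measure.measurable_coe hA).comp (measurable_iterKernel hκ m)).ennreal_toReal

lemma iterKernel_add_real (hκ : Measurable κ) (hprob : ∀ s, IsProbabilityMeasure (κ s))
    (m n : ℕ) (s : S) {A : Set S} (hA : MeasurableSet A) :
    (iterKernel κ (m + n) s).real A = ∫ x, (iterKernel κ n x).real A ∂iterKernel κ m s := by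
  have := isProbabilityMeasure_iterKernel hκ hprob
  rw [measureReal_def, iterKernel_add hκ,
    Measure.bind_apply hA (measurable_iterKernel hκ n).aemeasurable]
  refine (integral_toReal ((Measure.measurable_coe hA).comp
    (measurable_iterKernel hκ n)).aemeasurable ?_).symm
  exact Eventually.of_forall fun x => measure_lt_top _ _

/-- Geometric decay of the dependence of a Markov chain on its starting point. -/
lemma exists_iterKernel_real_sub_le (hκ : Measurable κ)
    (hprob : ∀ s, IsProbabilityMeasure (κ s)) {V : S → ℝ} (hV : Measurable V)
    (hV0 : ∀ s, 0 ≤ V s) {γ K : ℝ} (hγ0 : 0 ≤ γ) (hγ1 : γ < 1) (hK : 0 < K)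
    (hdrift : ∀ s, ∫⁻ x, ENNReal.ofReal (V x) ∂κ s ≤ ENNReal.ofReal (γ * V s + K))
    {n₀ : ℕ} (hn₀ : n₀ ≠ 0)
    (hmin : ∀ R : ℝ, ∃ α : ℝ, 0 < α ∧ ∃ ν : Measure S, IsProbabilityMeasure ν ∧
      ∀ s, V s ≤ R → ENNReal.ofReal α • ν ≤ iterKernel κ n₀ s) :
    ∃ β : ℝ, 0 < β ∧ ∃ ρ ∈ Set.Ioo (0 : ℝ) 1, ∃ C : ℝ, 0 < C ∧
      ∀ m A, MeasurableSet A → ∀ x y, (iterKernel κ m x).real A - (iterKernel κ m y).real A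
        ≤ C * ρ ^ m * ((1 + β * V x) + (1 + β * V y)) := by
  have hP := isProbabilityMeasure_iterKernel hκ hprob
  have h1γ : 0 < 1 - γ := by linarith
  have hK' : 0 < K / (1 - γ) := by positivity
  have hle := fun s => lintegral_iterKernel_le hκ hprob hV hV0 hγ0 hγ1 hK.le hdrift n₀ s
  obtain ⟨β, hβ, τ, ⟨hτ0, hτ1⟩, hcontr⟩ :=
    exists_weighted_oscillation_contraction (hP n₀) hV0
      (fun s => integrable_of_lintegral_ofReal_le hV hV0 (hle s)) hγ0 hγ1 hK'
      (fun s => by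
        have h0 := hV0 s
        refine (integral_le_of_lintegral_ofReal_le hV hV0 (by positivity) (hle s)).trans ?_
        gcongr
        exact pow_le_of_le_one hγ0 hγ1.le hn₀)
      (hmin _)
  have hosc : ∀ n k A, MeasurableSet A → ∀ x y,
      (iterKernel κ (n₀ * n + k) x).real A - (iterKernel κ (n₀ * n + k) y).real A
        ≤ τ ^ n * (1 + β * V x) + τ ^ n * (1 + β * V y) := by
    intro n k A hA
    induction n with
    | zero =>
      intro x y
      have h1 : (iterKernel κ (n₀ * 0 + k) x).real A ≤ 1 := measureReal_le_one
      have h2 : 0 ≤ (iterKernel κ (n₀ * 0 + k) y).real A := measureReal_nonneg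
      have := mul_nonneg hβ.le (hV0 x)
      have := mul_nonneg hβ.le (hV0 y)
      linarith
    | succ n ih =>
      intro x y
      have heq : n₀ * (n + 1) + k = n₀ + (n₀ * n + k) := by ring
      rw [heq, iterKernel_add_real hκ hprob _ _ x hA, iterKernel_add_real hκ hprob _ _ y hA,
        pow_succ']
      exact hcontr _ (measurable_iterKernel_real hκ _ hA)
        ⟨1, fun s => by rw [abs_of_nonneg measureReal_nonneg]; exact measureReal_le_one⟩
        _ (by positivity) ih x y
  set ρ := τ ^ ((n₀ : ℝ)⁻¹) with hρ
  have hρ0 : 0 < ρ := Real.rpow_pos_of_pos hτ0 _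
  have hρ1 : ρ < 1 := Real.rpow_lt_one hτ0.le hτ1 (by positivity)
  have hρτ : ρ ^ n₀ = τ := Real.rpow_inv_natCast_pow hτ0.le hn₀
  refine ⟨β, hβ, ρ, ⟨hρ0, hρ1⟩, τ⁻¹, by positivity, fun m A hA x y => ?_⟩
  have h1 := hosc (m / n₀) (m % n₀) A hA x y
  rw [Nat.div_add_mod, ← mul_add] at h1
  refine h1.trans (mul_le_mul_of_nonneg_right ?_ ?_)
  · rw [← hρτ, ← pow_mul, ← div_eq_inv_mul, le_div_iff₀ (by positivity), ← pow_add]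
    refine pow_le_pow_of_le_one hρ0.le hρ1.le ?_
    have := Nat.div_add_mod m n₀
    have := Nat.mod_lt m (Nat.pos_of_ne_zero hn₀)
    omega
  · have := hV0 x
    have := hV0 y
    positivity

/-- **Harris theorem**: a geometric drift condition, together with a minorization of some iterate
on every sublevel set of the Lyapunov function, implies geometric ergodicity. -/
theorem exists_invariant_of_drift_of_minorization [Nonempty S] (hκ : Measurable κ)
    (hprob : ∀ s, IsProbabilityMeasure (κ s)) {V : S → ℝ} (hV : Measurable V)
    (hV0 : ∀ s, 0 ≤ V s) {γ K : ℝ} (hγ0 : 0 ≤ γ) (hγ1 : γ < 1) (hK : 0 < K)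
    (hdrift : ∀ s, ∫⁻ x, ENNReal.ofReal (V x) ∂κ s ≤ ENNReal.ofReal (γ * V s + K))
    {n₀ : ℕ} (hn₀ : n₀ ≠ 0)
    (hmin : ∀ R : ℝ, ∃ α : ℝ, 0 < α ∧ ∃ ν : Measure S, IsProbabilityMeasure ν ∧
      ∀ s, V s ≤ R → ENNReal.ofReal α • ν ≤ iterKernel κ n₀ s) :
    ∃ π : Measure S, IsProbabilityMeasure π ∧ π.bind κ = π ∧ ∃ ρ ∈ Set.Ioo (0 : ℝ) 1,
      ∀ s, ∃ C : ℝ, ∀ n A, MeasurableSet A →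
        |(iterKernel κ n s).real A - π.real A| ≤ C * ρ ^ n := by
  obtain ⟨β, hβ, ρ, ⟨hρ0, hρ1⟩, C, hC, hosc⟩ :=
    exists_iterKernel_real_sub_le hκ hprob hV hV0 hγ0 hγ1 hK hdrift hn₀ hmin
  have hP := isProbabilityMeasure_iterKernel hκ hprob
  have h1γ : 0 < 1 - γ := by linarith
  have hosc' : ∀ m A, MeasurableSet A → ∀ x y,
      |(iterKernel κ m x).real A - (iterKernel κ m y).real A|
        ≤ C * ρ ^ m * ((1 + β * V x) + (1 + β * V y)) := fun m A hA x y =>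
    abs_sub_le_iff.2 ⟨hosc m A hA x y, by rw [add_comm (1 + β * V x)]; exact hosc m A hA y x⟩
  obtain ⟨x₀⟩ := ‹Nonempty S›
  set D := C * ((1 + β * V x₀) + (1 + β * (V x₀ + K / (1 - γ)))) with hD
  have hcauchy : ∀ m k A, MeasurableSet A →
      |(iterKernel κ (m + k) x₀).real A - (iterKernel κ m x₀).real A| ≤ D * ρ ^ m := by
    intro m k A hA
    have hle := lintegral_iterKernel_le hκ hprob hV hV0 hγ0 hγ1 hK.le hdrift k x₀
    have hVi := integrable_of_lintegral_ofReal_le hV hV0 hle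
    have h0 := hV0 x₀
    have hVle : ∫ z, V z ∂iterKernel κ k x₀ ≤ V x₀ + K / (1 - γ) := by
      refine (integral_le_of_lintegral_ofReal_le hV hV0 (by positivity) hle).trans ?_
      gcongr
      exact mul_le_of_le_one_left h0 (pow_le_one₀ hγ0 hγ1.le)
    have hgi : Integrable (fun z => (iterKernel κ m z).real A) (iterKernel κ k x₀) :=
      Integrable.of_bound (measurable_iterKernel_real hκ m hA).aestronglyMeasurable 1
        (Eventually.of_forall fun z => by
          rw [Real.norm_of_nonneg measureReal_nonneg]; exact measureReal_le_one)
    have heq : (iterKernel κ (m + k) x₀).real A - (iterKernel κ m x₀).real A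
        = ∫ z, ((iterKernel κ m z).real A - (iterKernel κ m x₀).real A)
            ∂iterKernel κ k x₀ := by
      rw [integral_sub hgi (integrable_const _), add_comm m k,
        iterKernel_add_real hκ hprob k m x₀ hA]
      simp
    rw [heq]
    have hLi : Integrable (fun z => 1 + β * V z) (iterKernel κ k x₀) :=
      (integrable_const 1).add (hVi.const_mul β)
    have hWi : Integrable (fun z => C * ρ ^ m * ((1 + β * V z) + (1 + β * V x₀)))
        (iterKernel κ k x₀) :=
      (hLi.add (integrable_const _)).const_mul _
    calc |∫ z, ((iterKernel κ m z).real A - (iterKernel κ m x₀).real A) ∂iterKernel κ k x₀|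
        ≤ ∫ z, |(iterKernel κ m z).real A - (iterKernel κ m x₀).real A| ∂iterKernel κ k x₀ :=
          abs_integral_le_integral_abs
      _ ≤ ∫ z, C * ρ ^ m * ((1 + β * V z) + (1 + β * V x₀)) ∂iterKernel κ k x₀ :=
          integral_mono (hgi.sub (integrable_const _)).abs hWi fun z => hosc' m A hA z x₀
      _ = C * ρ ^ m * ((1 + β * ∫ z, V z ∂iterKernel κ k x₀) + (1 + β * V x₀)) := by
          rw [integral_const_mul, integral_add hLi (integrable_const _),
            integral_add (integrable_const 1) (hVi.const_mul β), integral_const_mul]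
          simp
      _ ≤ C * ρ ^ m * ((1 + β * (V x₀ + K / (1 - γ))) + (1 + β * V x₀)) := by gcongr
      _ = D * ρ ^ m := by rw [hD]; ring
  have hDρ : Tendsto (fun m => D * ρ ^ m) atTop (𝓝 0) := by
    simpa using (tendsto_pow_atTop_nhds_zero_of_lt_one hρ0.le hρ1).const_mul D
  obtain ⟨π, hπ, hclose⟩ :=
    exists_probabilityMeasure_abs_sub_le (fun m => hP m x₀) hDρ hcauchy
  refine ⟨π, hπ, bind_eq_self_of_tendsto hκ hprob (s := x₀) fun A hA => ?_, ρ, ⟨hρ0, hρ1⟩,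
    fun s => ⟨C * ((1 + β * V s) + (1 + β * V x₀)) + D, fun n A hA => ?_⟩⟩
  · rw [← ENNReal.tendsto_toReal_iff (fun m => measure_ne_top _ _) (measure_ne_top _ _),
      tendsto_iff_dist_tendsto_zero]
    exact squeeze_zero (fun _ => dist_nonneg) (fun m => hclose m A hA) hDρ
  · calc |(iterKernel κ n s).real A - π.real A|
        ≤ |(iterKernel κ n s).real A - (iterKernel κ n x₀).real A|
            + |(iterKernel κ n x₀).real A - π.real A| := abs_sub_le _ _ _
      _ ≤ C * ρ ^ n * ((1 + β * V s) + (1 + β * V x₀)) + D * ρ ^ n :=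
          add_le_add (hosc' n A hA s x₀) (hclose n A hA)
      _ = _ := by ring

end HarrisTheorem

section Dynamics

variable {p : ℕ}

/-- The regime after one step from the state `s`. -/
def nextRegime (d : Fin p) (rL rU : ℝ) (s : (Fin p → ℝ) × Bool) : Bool :=
  if s.1 d ≤ rL then true else if rU < s.1 d then false else s.2

/-- The state after one step from `s` when the new observation is `z`. -/
def pushState (d : Fin p) (rL rU : ℝ) (s : (Fin p → ℝ) × Bool) (z : ℝ) : (Fin p → ℝ) × Bool :=
  (fun k => if _ : (k : ℕ) = 0 then z else s.1 ⟨(k : ℕ) - 1, by have := k.isLt; omega⟩,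
    nextRegime d rL rU s)

/-- The index of the coefficients used in the step from the state `s`. -/
def activeIndex (d : Fin p) (rL rU : ℝ) (s : (Fin p → ℝ) × Bool) : Fin 2 :=
  if nextRegime d rL rU s then 0 else 1

/-- The conditional mean of the new observation. -/
def condMean (φ0 : Fin 2 → ℝ) (φ : Fin 2 → Fin p → ℝ) (i : Fin 2) (y : Fin p → ℝ) : ℝ :=
  φ0 i + ∑ j, φ i j * y j

/-- The conditional variance of the new observation. -/
def condVar (α0 : Fin 2 → ℝ) (α : Fin 2 → Fin p → ℝ) (i : Fin 2) (y : Fin p → ℝ) : ℝ :=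
  α0 i + ∑ j, α i j * y j ^ 2

lemma bdarStep_eq_pushState (d : Fin p) (rL rU : ℝ) (φ0 : Fin 2 → ℝ) (φ : Fin 2 → Fin p → ℝ)
    (α0 : Fin 2 → ℝ) (α : Fin 2 → Fin p → ℝ) (s : (Fin p → ℝ) × Bool) (ε : ℝ) :
    bdarStep p d rL rU φ0 φ α0 α s ε = pushState d rL rU s
      (condMean φ0 φ (activeIndex d rL rU s) s.1
        + ε * Real.sqrt (condVar α0 α (activeIndex d rL rU s) s.1)) :=
  rfl

lemma measurable_nextRegime (d : Fin p) (rL rU : ℝ) : Measurable (nextRegime d rL rU) := by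
  have hd : Measurable fun s : (Fin p → ℝ) × Bool => s.1 d :=
    (measurable_pi_apply d).comp measurable_fst
  exact Measurable.ite (measurableSet_le hd measurable_const) measurable_const
    (Measurable.ite (measurableSet_lt measurable_const hd) measurable_const measurable_snd)

lemma measurable_activeIndex (d : Fin p) (rL rU : ℝ) : Measurable (activeIndex d rL rU) :=
  (measurable_of_finite fun R : Bool => if R then (0 : Fin 2) else 1).comp
    (measurable_nextRegime d rL rU)

lemma measurable_uncurry_pushState (d : Fin p) (rL rU : ℝ) :
    Measurable (Function.uncurry (pushState d rL rU)) := by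
  refine Measurable.prodMk (measurable_pi_lambda _ fun k => ?_)
    ((measurable_nextRegime d rL rU).comp measurable_fst)
  by_cases hk : (k : ℕ) = 0
  · simp only [hk, dite_true]
    exact measurable_snd
  · simp only [hk, dite_false]
    exact (measurable_pi_apply _).comp (measurable_fst.comp measurable_fst)

lemma measurable_uncurry_bdarStep (d : Fin p) (rL rU : ℝ) (φ0 : Fin 2 → ℝ)
    (φ : Fin 2 → Fin p → ℝ) (α0 : Fin 2 → ℝ) (α : Fin 2 → Fin p → ℝ) :
    Measurable (Function.uncurry (bdarStep p d rL rU φ0 φ α0 α)) := by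
  have hcoef : ∀ g : Fin 2 → ℝ, Measurable fun q : ((Fin p → ℝ) × Bool) × ℝ =>
      g (activeIndex d rL rU q.1) := fun g =>
    (measurable_of_finite g).comp ((measurable_activeIndex d rL rU).comp measurable_fst)
  have hlag : ∀ j, Measurable fun q : ((Fin p → ℝ) × Bool) × ℝ => q.1.1 j := fun j =>
    (measurable_pi_apply j).comp (measurable_fst.comp measurable_fst)
  have hmean : Measurable fun q : ((Fin p → ℝ) × Bool) × ℝ =>
      condMean φ0 φ (activeIndex d rL rU q.1) q.1.1 :=
    (hcoef φ0).add (Finset.measurable_fun_sum _ fun j _ =>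
      (hcoef fun i => φ i j).mul (hlag j))
  have hvar : Measurable fun q : ((Fin p → ℝ) × Bool) × ℝ =>
      condVar α0 α (activeIndex d rL rU q.1) q.1.1 :=
    (hcoef α0).add (Finset.measurable_fun_sum _ fun j _ =>
      (hcoef fun i => α i j).mul ((hlag j).pow_const 2))
  exact (measurable_uncurry_pushState d rL rU).comp
    (measurable_fst.prodMk (hmean.add (measurable_snd.mul hvar.sqrt)))

/-- A parametrized push-forward of a fixed measure depends measurably on the parameter. -/
lemma measurable_map_of_measurable_uncurry {S T : Type*} [MeasurableSpace S] [MeasurableSpace T]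
    (ν : Measure ℝ) [SFinite ν] {g : S → ℝ → T} (hg : Measurable (Function.uncurry g)) :
    Measurable fun s => ν.map (g s) := by
  refine Measure.measurable_of_measurable_coe _ fun A hA => ?_
  have h1 : ∀ s, ν.map (g s) A = ν (Prod.mk s ⁻¹' (Function.uncurry g ⁻¹' A)) := fun s =>
    Measure.map_apply (hg.comp measurable_prodMk_left) hA
  simp_rw [h1]
  exact measurable_measure_prodMk_left (hg hA)

end Dynamics

section Minorization

lemma smul_iterKernel_le {S : Type*} [MeasurableSpace S] {κ l : S → Measure S}
    (hκ : Measurable κ) (hl : Measurable l) {D : Set S} {c : ℝ≥0∞}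
    (hle : ∀ s ∈ D, c • l s ≤ κ s) (hD : ∀ s ∈ D, ∀ᵐ x ∂l s, x ∈ D) (n : ℕ) :
    ∀ s ∈ D, c ^ n • iterKernel l n s ≤ iterKernel κ n s := by
  induction n with
  | zero =>
    intro s _
    rw [pow_zero, one_smul]
    exact le_rfl
  | succ n ih =>
    intro s hs
    refine Measure.le_iff.2 fun A hA => ?_
    have hκn := measurable_iterKernel hκ n
    have hln := measurable_iterKernel hl n
    have hlA : Measurable fun x => iterKernel l n x A := (Measure.measurable_coe hA).comp hln
    rw [add_comm n 1, Measure.smul_apply, iterKernel_add hκ, iterKernel_add hl,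
      iterKernel_one hκ, iterKernel_one hl, Measure.bind_apply hA hκn.aemeasurable,
      Measure.bind_apply hA hln.aemeasurable, smul_eq_mul, pow_add, pow_one, mul_assoc]
    calc c * (c ^ n * ∫⁻ x, iterKernel l n x A ∂l s)
        = c * ∫⁻ x, c ^ n * iterKernel l n x A ∂l s := by
          rw [lintegral_const_mul _ hlA]
      _ ≤ c * ∫⁻ x, iterKernel κ n x A ∂l s := by
          gcongr 1
          refine lintegral_mono_ae ((hD s hs).mono fun x hx => ?_)
          simpa using Measure.le_iff.1 (ih x hx) A hA
      _ = ∫⁻ x, iterKernel κ n x A ∂(c • l s) := by rw [lintegral_smul_measure, smul_eq_mul]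
      _ ≤ ∫⁻ x, iterKernel κ n x A ∂κ s := lintegral_mono' (hle s hs) le_rfl

variable {p : ℕ}

/-- The chain whose observations are uniform on `[rL - 1, rL]`, independently of the past. -/
def uniformKernel (d : Fin p) (rL rU : ℝ) (s : (Fin p → ℝ) × Bool) :
    Measure ((Fin p → ℝ) × Bool) :=
  (volume.restrict (Set.Icc (rL - 1) rL)).map (pushState d rL rU s)

lemma measurable_uniformKernel (d : Fin p) (rL rU : ℝ) : Measurable (uniformKernel d rL rU) :=
  measurable_map_of_measurable_uncurry _ (measurable_uncurry_pushState d rL rU)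

lemma measurable_pushState (d : Fin p) (rL rU : ℝ) (s : (Fin p → ℝ) × Bool) :
    Measurable (pushState d rL rU s) :=
  (measurable_uncurry_pushState d rL rU).comp measurable_prodMk_left

lemma isProbabilityMeasure_uniformKernel (d : Fin p) (rL rU : ℝ) (s : (Fin p → ℝ) × Bool) :
    IsProbabilityMeasure (uniformKernel d rL rU s) :=
  ⟨by simp [uniformKernel, Measure.map_apply (measurable_pushState d rL rU s) MeasurableSet.univ]⟩

/-- Two states agree on their `k` most recent lags, which all lie in `[rL - 1, rL]`, and their
regimes agree once this is forced by those lags. -/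
def Coalesced (d : Fin p) (rL : ℝ) (k : ℕ) (s t : (Fin p → ℝ) × Bool) : Prop :=
  (∀ j : Fin p, (j : ℕ) < k → s.1 j = t.1 j ∧ s.1 j ∈ Set.Icc (rL - 1) rL) ∧
    ((d : ℕ) + 2 ≤ k → s.2 = t.2)

lemma Coalesced.eq {d : Fin p} {rL : ℝ} {s t : (Fin p → ℝ) × Bool}
    (h : Coalesced d rL (p + 1) s t) : s = t :=
  Prod.ext (funext fun j => (h.1 j (by have := j.isLt; omega)).1)
    (h.2 (by have := d.isLt; omega))

lemma Coalesced.pushState {d : Fin p} {rL : ℝ} (rU : ℝ) {k : ℕ} {s t : (Fin p → ℝ) × Bool}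
    (h : Coalesced d rL k s t) {z : ℝ} (hz : z ∈ Set.Icc (rL - 1) rL) :
    Coalesced d rL (k + 1) (pushState d rL rU s z) (pushState d rL rU t z) := by
  refine ⟨fun j hj => ?_, fun hk => ?_⟩
  · by_cases h0 : (j : ℕ) = 0
    · simpa [_root_.pushState, h0] using hz
    · simpa [_root_.pushState, h0] using h.1 ⟨(j : ℕ) - 1, by omega⟩ (by simp; omega)
  · obtain ⟨h1, h2⟩ := h.1 d (by omega)
    simp [_root_.pushState, nextRegime, ← h1, h2.2]

lemma iterKernel_uniformKernel_eq_of_coalesced {d : Fin p} {rL rU : ℝ} (n : ℕ) :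
    ∀ {k : ℕ} {s t : (Fin p → ℝ) × Bool}, n + k = p + 1 → Coalesced d rL k s t →
      iterKernel (uniformKernel d rL rU) n s = iterKernel (uniformKernel d rL rU) n t := by
  induction n with
  | zero =>
    intro k s t hk h
    obtain rfl : k = p + 1 := by omega
    rw [h.eq]
  | succ n ih =>
    intro k s t hk h
    have hm := measurable_uniformKernel d rL rU
    have hmn := measurable_iterKernel hm n
    ext A hA
    have hmA : Measurable fun x => iterKernel (uniformKernel d rL rU) n x A :=
      (Measure.measurable_coe hA).comp hmn
    rw [add_comm n 1, iterKernel_add hm, iterKernel_add hm, iterKernel_one hm,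
      Measure.bind_apply hA hmn.aemeasurable, Measure.bind_apply hA hmn.aemeasurable,
      uniformKernel, uniformKernel,
      lintegral_map hmA (measurable_pushState d rL rU s),
      lintegral_map hmA (measurable_pushState d rL rU t)]
    refine setLIntegral_congr_fun measurableSet_Icc fun z hz => ?_
    simp only [ih (k := k + 1) (by omega) (h.pushState rU hz)]

lemma iterKernel_uniformKernel_eq (d : Fin p) (rL rU : ℝ) (s t : (Fin p → ℝ) × Bool) :
    iterKernel (uniformKernel d rL rU) (p + 1) s
      = iterKernel (uniformKernel d rL rU) (p + 1) t :=
  iterKernel_uniformKernel_eq_of_coalesced (p + 1) (k := 0) rfl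
    ⟨fun j hj => absurd hj (Nat.not_lt_zero _), fun h => absurd h (by omega)⟩

lemma exists_pos_ofReal_le_of_locally {f : ℝ → ℝ≥0∞}
    (hf : ∀ x : ℝ, ∃ c : ℝ≥0∞, 0 < c ∧ ∃ δ : ℝ, 0 < δ ∧ ∀ z, |z - x| < δ → c ≤ f z)
    {s : Set ℝ} (hs : IsCompact s) : ∃ c : ℝ, 0 < c ∧ ∀ z ∈ s, ENNReal.ofReal c ≤ f z := by
  refine hs.induction_on (p := fun s => ∃ c : ℝ, 0 < c ∧ ∀ z ∈ s, ENNReal.ofReal c ≤ f z)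
    ⟨1, one_pos, by simp⟩ (fun s t hst ⟨c, hc, h⟩ => ⟨c, hc, fun z hz => h z (hst hz)⟩) ?_ ?_
  · rintro s t ⟨c, hc, h⟩ ⟨c', hc', h'⟩
    refine ⟨min c c', lt_min hc hc', ?_⟩
    rintro z (hz | hz)
    · exact (ENNReal.ofReal_le_ofReal (min_le_left _ _)).trans (h z hz)
    · exact (ENNReal.ofReal_le_ofReal (min_le_right _ _)).trans (h' z hz)
  · intro x _
    obtain ⟨c, hc, δ, hδ, h⟩ := hf x
    have hne : min c 1 ≠ ⊤ := ne_top_of_le_ne_top ENNReal.one_ne_top (min_le_right _ _)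
    refine ⟨Metric.ball x δ, mem_nhdsWithin_of_mem_nhds (Metric.ball_mem_nhds x hδ),
      (min c 1).toReal, ENNReal.toReal_pos (lt_min hc one_pos).ne' hne, fun z hz => ?_⟩
    rw [ENNReal.ofReal_toReal hne]
    exact (min_le_left _ _).trans (h z (by simpa [Real.dist_eq] using hz))

/-- An affine image of a measure with density bounded below by `c` on a compact interval is
bounded below by a multiple of Lebesgue measure. -/
lemma ofReal_mul_volume_le_preimage_affine {f : ℝ → ℝ≥0∞} {c T : ℝ}
    (hf : ∀ z ∈ Set.Icc (-T) T, ENNReal.ofReal c ≤ f z) (hc : 0 ≤ c) {m σ σ' : ℝ} (hσ : 0 < σ)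
    (hσ' : σ ≤ σ') {E : Set ℝ} (hE : MeasurableSet E) (hT : ∀ z ∈ E, |z - m| ≤ T * σ) :
    ENNReal.ofReal (c / σ') * volume E
      ≤ (volume.withDensity f) ((fun ε => m + ε * σ) ⁻¹' E) := by
  have hmeas : MeasurableSet ((fun ε => m + ε * σ) ⁻¹' E) :=
    ((measurable_id.mul_const σ).const_add m) hE
  have hvol : volume ((fun ε => m + ε * σ) ⁻¹' E) = ENNReal.ofReal σ⁻¹ * volume E := by
    have : (fun ε => m + ε * σ) ⁻¹' E = (fun ε => ε * σ) ⁻¹' ((fun x => m + x) ⁻¹' E) := rfl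
    rw [this, Real.volume_preimage_mul_right hσ.ne', measure_preimage_add,
      abs_of_pos (inv_pos.2 hσ)]
  rw [withDensity_apply _ hmeas]
  calc ENNReal.ofReal (c / σ') * volume E
      ≤ ENNReal.ofReal (c * σ⁻¹) * volume E := by
        rw [← div_eq_mul_inv]
        gcongr
    _ = ∫⁻ _ in (fun ε => m + ε * σ) ⁻¹' E, ENNReal.ofReal c := by
        rw [setLIntegral_const, hvol, ENNReal.ofReal_mul hc, mul_assoc]
    _ ≤ ∫⁻ ε in (fun ε => m + ε * σ) ⁻¹' E, f ε := by
        refine setLIntegral_mono' hmeas fun ε hε => hf ε (abs_le.1 ?_)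
        have h1 := hT _ hε
        rw [add_sub_cancel_left, abs_mul, abs_of_pos hσ] at h1
        exact le_of_mul_le_mul_right h1 hσ

end Minorization

section BdarMinorization

variable {p : ℕ}

lemma abs_condMean_le (φ0 : Fin 2 → ℝ) (φ : Fin 2 → Fin p → ℝ) (i : Fin 2) {y : Fin p → ℝ}
    {T : ℝ} (hy : ∀ j, |y j| ≤ T) :
    |condMean φ0 φ i y| ≤ ∑ i, (|φ0 i| + ∑ j, |φ i j| * T) := by
  have hT : ∀ j : Fin p, 0 ≤ T := fun j => (abs_nonneg _).trans (hy j)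
  calc |condMean φ0 φ i y| ≤ |φ0 i| + ∑ j, |φ i j * y j| :=
        (abs_add_le _ _).trans (add_le_add le_rfl (Finset.abs_sum_le_sum_abs _ _))
    _ ≤ |φ0 i| + ∑ j, |φ i j| * T := by
        gcongr with j
        rw [abs_mul]
        exact mul_le_mul_of_nonneg_left (hy j) (abs_nonneg _)
    _ ≤ _ := Finset.single_le_sum (f := fun i => |φ0 i| + ∑ j, |φ i j| * T)
        (fun i _ => add_nonneg (abs_nonneg _)
          (Finset.sum_nonneg fun j _ => mul_nonneg (abs_nonneg _) (hT j))) (Finset.mem_univ i)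

lemma condVar_le {α0 : Fin 2 → ℝ} {α : Fin 2 → Fin p → ℝ} (hα0 : ∀ i, 0 < α0 i)
    (hα : ∀ i j, 0 ≤ α i j) (i : Fin 2) {y : Fin p → ℝ} {T : ℝ} (hy : ∀ j, |y j| ≤ T) :
    condVar α0 α i y ≤ ∑ i, (α0 i + ∑ j, α i j * T ^ 2) := by
  calc condVar α0 α i y ≤ α0 i + ∑ j, α i j * T ^ 2 := by
        unfold condVar
        refine add_le_add le_rfl (Finset.sum_le_sum fun j _ => ?_)
        exact mul_le_mul_of_nonneg_left (sq_le_sq' (abs_le.1 (hy j)).1 (abs_le.1 (hy j)).2) (hα i j)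
    _ ≤ _ := Finset.single_le_sum (f := fun i => α0 i + ∑ j, α i j * T ^ 2)
        (fun i _ => add_nonneg (hα0 i).le
          (Finset.sum_nonneg fun j _ => mul_nonneg (hα i j) (sq_nonneg T))) (Finset.mem_univ i)

lemma le_condVar {α0 : Fin 2 → ℝ} {α : Fin 2 → Fin p → ℝ} (hα : ∀ i j, 0 ≤ α i j) (i : Fin 2)
    (y : Fin p → ℝ) : α0 i ≤ condVar α0 α i y :=
  le_add_of_nonneg_right (Finset.sum_nonneg fun j _ => mul_nonneg (hα i j) (sq_nonneg _))

/-- On bounded sets of states, the BDAR kernel dominates a multiple of the uniform kernel. -/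
lemma exists_smul_uniformKernel_le (d : Fin p) (rL rU : ℝ) (φ0 : Fin 2 → ℝ)
    (φ : Fin 2 → Fin p → ℝ) {α0 : Fin 2 → ℝ} {α : Fin 2 → Fin p → ℝ} (hα0 : ∀ i, 0 < α0 i)
    (hα : ∀ i j, 0 ≤ α i j) {f : ℝ → ℝ≥0∞}
    (hf : ∀ x : ℝ, ∃ c : ℝ≥0∞, 0 < c ∧ ∃ δ : ℝ, 0 < δ ∧ ∀ z, |z - x| < δ → c ≤ f z) (T : ℝ) :
    ∃ c : ℝ, 0 < c ∧ ∀ s : (Fin p → ℝ) × Bool, (∀ j, |s.1 j| ≤ T) →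
      ENNReal.ofReal c • uniformKernel d rL rU s
        ≤ (volume.withDensity f).map (bdarStep p d rL rU φ0 φ α0 α s) := by
  set L := ∑ i, (|φ0 i| + ∑ j, |φ i j| * T)
  set v := min (α0 0) (α0 1) with hv
  have hv0 : 0 < v := lt_min (hα0 0) (hα0 1)
  have hvα : ∀ i, v ≤ α0 i := by
    intro i
    fin_cases i
    · exact min_le_left _ _
    · exact min_le_right _ _
  set v' := ∑ i, (α0 i + ∑ j, α i j * T ^ 2)
  have hv' : 0 < v' := Finset.sum_pos (fun i _ => add_pos_of_pos_of_nonneg (hα0 i)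
    (Finset.sum_nonneg fun j _ => mul_nonneg (hα i j) (sq_nonneg T))) Finset.univ_nonempty
  obtain ⟨c, hc, hcf⟩ := exists_pos_ofReal_le_of_locally hf
    (isCompact_Icc (a := -((|rL| + 1 + L) / √v)) (b := (|rL| + 1 + L) / √v))
  refine ⟨c / √v', by positivity, fun s hs => Measure.le_iff.2 fun A hA => ?_⟩
  have hB := measurable_pushState d rL rU s hA
  set i := activeIndex d rL rU s
  have hstep : Measurable (bdarStep p d rL rU φ0 φ α0 α s) :=
    (measurable_uncurry_bdarStep d rL rU φ0 φ α0 α).comp measurable_prodMk_left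
  have hσ : √v ≤ √(condVar α0 α i s.1) :=
    Real.sqrt_le_sqrt ((hvα i).trans (le_condVar hα i s.1))
  have hσ0 : 0 < √v := Real.sqrt_pos.2 hv0
  rw [Measure.smul_apply, smul_eq_mul, uniformKernel,
    Measure.map_apply (measurable_pushState d rL rU s) hA, Measure.restrict_apply hB,
    Measure.map_apply hstep hA]
  refine (ofReal_mul_volume_le_preimage_affine hcf hc.le (hσ0.trans_le hσ)
    (Real.sqrt_le_sqrt (condVar_le hα0 hα i hs)) (hB.inter measurableSet_Icc)
    (m := condMean φ0 φ i s.1) ?_).trans (measure_mono fun ε hε => hε.1)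
  rintro z ⟨-, hz⟩
  have hL := abs_condMean_le φ0 φ i hs
  have hz' : |z| ≤ |rL| + 1 := by
    rw [abs_le]
    constructor <;> linarith [hz.1, hz.2, neg_abs_le rL, le_abs_self rL]
  have h1 : |z - condMean φ0 φ i s.1| ≤ |rL| + 1 + L :=
    (abs_sub _ _).trans (add_le_add hz' hL)
  calc |z - condMean φ0 φ i s.1| ≤ (|rL| + 1 + L) / √v * √v := by
        rwa [div_mul_cancel₀ _ hσ0.ne']
    _ ≤ _ := by
        have := (abs_nonneg _).trans h1
        gcongr

/-- The `(p + 1)`-step BDAR kernel satisfies a minorization condition on bounded sets. -/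
lemma exists_bdar_minorization (d : Fin p) (rL rU : ℝ) (φ0 : Fin 2 → ℝ)
    (φ : Fin 2 → Fin p → ℝ) {α0 : Fin 2 → ℝ} {α : Fin 2 → Fin p → ℝ} (hα0 : ∀ i, 0 < α0 i)
    (hα : ∀ i j, 0 ≤ α i j) {f : ℝ → ℝ≥0∞}
    (hf : ∀ x : ℝ, ∃ c : ℝ≥0∞, 0 < c ∧ ∃ δ : ℝ, 0 < δ ∧ ∀ z, |z - x| < δ → c ≤ f z)
    {κ : (Fin p → ℝ) × Bool → Measure ((Fin p → ℝ) × Bool)} (hκm : Measurable κ)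
    (hκ : ∀ s, κ s = (volume.withDensity f).map (bdarStep p d rL rU φ0 φ α0 α s)) (T : ℝ) :
    ∃ c : ℝ, 0 < c ∧ ∃ ν : Measure ((Fin p → ℝ) × Bool), IsProbabilityMeasure ν ∧
      ∀ s : (Fin p → ℝ) × Bool, (∀ j, |s.1 j| ≤ T) →
        ENNReal.ofReal c • ν ≤ iterKernel κ (p + 1) s := by
  set T' := max T (|rL| + 1)
  obtain ⟨c, hc, hle⟩ := exists_smul_uniformKernel_le d rL rU φ0 φ hα0 hα hf T'
  have hm := measurable_uniformKernel d rL rU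
  refine ⟨c ^ (p + 1), by positivity, iterKernel (uniformKernel d rL rU) (p + 1) (0, true),
    isProbabilityMeasure_iterKernel hm (isProbabilityMeasure_uniformKernel d rL rU) _ _,
    fun s hs => ?_⟩
  rw [iterKernel_uniformKernel_eq d rL rU (0, true) s, ENNReal.ofReal_pow hc.le]
  refine smul_iterKernel_le (D := {s | ∀ j, |s.1 j| ≤ T'}) hκm hm
    (fun s hs => by rw [hκ]; exact hle s hs) (fun s hs => ?_) (p + 1) s
    fun j => (hs j).trans (le_max_left _ _)
  have hD : MeasurableSet {s : (Fin p → ℝ) × Bool | ∀ j, |s.1 j| ≤ T'} := by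
    rw [Set.ofPred_forall]
    refine MeasurableSet.iInter fun j => measurableSet_le ?_ measurable_const
    exact ((measurable_pi_apply j).comp measurable_fst).abs
  refine (ae_map_iff (measurable_pushState d rL rU s).aemeasurable hD).2 ?_
  refine (ae_restrict_mem measurableSet_Icc).mono fun z hz j => ?_
  by_cases h0 : (j : ℕ) = 0
  · have : |z| ≤ |rL| + 1 := by
      rw [abs_le]
      constructor <;> linarith [hz.1, hz.2, neg_abs_le rL, le_abs_self rL]
    simp only [pushState, h0, dite_true]
    exact this.trans (le_max_right _ _)
  · simp only [pushState, h0, dite_false]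
    exact hs _

end BdarMinorization

section Lyapunov

variable {p : ℕ}

lemma sum_mul_pushState (hp : 1 ≤ p) (d : Fin p) (rL rU : ℝ) (s : (Fin p → ℝ) × Bool) (z : ℝ)
    {w : ℕ → ℝ} (hw : w p = 0) (h : ℝ → ℝ) :
    ∑ j : Fin p, w j * h ((pushState d rL rU s z).1 j)
      = w 0 * h z + ∑ j : Fin p, w ((j : ℕ) + 1) * h (s.1 j) := by
  obtain ⟨q, rfl⟩ := Nat.exists_eq_add_of_le' hp
  rw [Fin.sum_univ_succ,
    Fin.sum_univ_castSucc (n := q) fun j : Fin (q + 1) => w ((j : ℕ) + 1) * h (s.1 j)]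
  have h1 : ∀ j : Fin q, (pushState d rL rU s z).1 j.succ = s.1 j.castSucc := fun j => by
    simp [pushState, Fin.castSucc, Fin.castAdd, Fin.castLE]
  simp only [h1, Fin.val_succ, Fin.val_castSucc, Fin.val_last, hw]
  simp [pushState]

/-- A moment bound with coefficients summing to less than one yields a Lyapunov function with
bounded sublevel sets. -/
lemma exists_lyapunov (hp : 1 ≤ p) (d : Fin p) (rL rU : ℝ) (φ0 : Fin 2 → ℝ)
    (φ : Fin 2 → Fin p → ℝ) (α0 : Fin 2 → ℝ) (α : Fin 2 → Fin p → ℝ) (μ : Measure ℝ)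
    [IsProbabilityMeasure μ] {r : ℝ} (hr : 0 < r) {c : Fin p → ℝ} (hc0 : ∀ j, 0 ≤ c j)
    (hc1 : ∑ j, c j < 1) {K : ℝ} (hK : 0 < K)
    (hmom : ∀ i y, ∫⁻ ε, ENNReal.ofReal (|condMean φ0 φ i y + ε * √(condVar α0 α i y)| ^ r) ∂μ
      ≤ ENNReal.ofReal (∑ j, c j * |y j| ^ r + K)) :
    ∃ V : (Fin p → ℝ) × Bool → ℝ, Measurable V ∧ (∀ s, 0 ≤ V s) ∧
      (∃ γ : ℝ, 0 ≤ γ ∧ γ < 1 ∧ ∀ s,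
        ∫⁻ x, ENNReal.ofReal (V x) ∂μ.map (bdarStep p d rL rU φ0 φ α0 α s)
          ≤ ENNReal.ofReal (γ * V s + K)) ∧
      ∀ R : ℝ, ∃ T : ℝ, ∀ s, V s ≤ R → ∀ j, |s.1 j| ≤ T := by
  have hp0 : (0 : ℝ) < p := by exact_mod_cast hp
  set η := (1 - ∑ j, c j) / p with hη
  have hη0 : 0 < η := div_pos (by linarith) hp0
  have hηp : p * η = 1 - ∑ j, c j := by rw [hη]; field_simp
  have hη1 : η ≤ 1 := by
    have h1 : (1 : ℝ) ≤ p := by exact_mod_cast hp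
    have h2 : 0 ≤ ∑ j, c j := Finset.sum_nonneg fun j _ => hc0 j
    nlinarith
  set w : ℕ → ℝ := fun n => ∑ i : Fin p, if n ≤ (i : ℕ) then c i + η else 0 with hw
  have hcη : ∀ i, 0 ≤ c i + η := fun i => add_nonneg (hc0 i) hη0.le
  have hw0 : ∀ n, 0 ≤ w n := fun n => Finset.sum_nonneg fun i _ => by
    split_ifs
    exacts [hcη i, le_rfl]
  have hwp : w p = 0 := Finset.sum_eq_zero fun i _ => if_neg (by have := i.isLt; omega)
  have hw_zero : w 0 = 1 := by
    simp only [hw, Nat.zero_le, if_true, Finset.sum_add_distrib, Finset.sum_const,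
      Finset.card_univ, Fintype.card_fin, nsmul_eq_mul, hηp]
    ring
  have hw1 : ∀ n, w n ≤ 1 := fun n => by
    rw [← hw_zero]
    refine Finset.sum_le_sum fun i _ => ?_
    simp only [Nat.zero_le, if_true]
    split_ifs
    exacts [le_rfl, hcη i]
  have hw_succ : ∀ j : Fin p, w j = (c j + η) + w ((j : ℕ) + 1) := by
    intro j
    have h1 : ∀ i : Fin p, (if (j : ℕ) ≤ (i : ℕ) then c i + η else 0)
        = (if j = i then c i + η else 0) + if (j : ℕ) + 1 ≤ (i : ℕ) then c i + η else 0 := by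
      intro i
      rcases lt_trichotomy (j : ℕ) (i : ℕ) with h | h | h
      · rw [if_pos h.le, if_neg (fun h' => by simp [h'] at h), if_pos (Nat.succ_le_of_lt h),
          zero_add]
      · rw [if_pos h.le, if_pos (Fin.ext h), if_neg (by omega), add_zero]
      · rw [if_neg (by omega), if_neg (fun h' => by simp [h'] at h), if_neg (by omega), zero_add]
    simp only [hw, h1, Finset.sum_add_distrib (f := fun i => if j = i then c i + η else 0)]
    simp
  have hV0 : ∀ s : (Fin p → ℝ) × Bool, 0 ≤ ∑ j : Fin p, w j * |s.1 j| ^ r := fun s =>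
    Finset.sum_nonneg fun j _ => mul_nonneg (hw0 _) (Real.rpow_nonneg (abs_nonneg _) _)
  have hVm : Measurable fun s : (Fin p → ℝ) × Bool => ∑ j : Fin p, w j * |s.1 j| ^ r :=
    Finset.measurable_fun_sum _ fun j _ =>
      ((((measurable_pi_apply j).comp measurable_fst).abs).pow_const r).const_mul _
  refine ⟨fun s => ∑ j : Fin p, w j * |s.1 j| ^ r, hVm, hV0,
    ⟨1 - η, by linarith, by linarith, fun s => ?_⟩, fun R => ⟨(R / η) ^ r⁻¹, fun s hs j => ?_⟩⟩
  · have hstep : Measurable (bdarStep p d rL rU φ0 φ α0 α s) :=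
      (measurable_uncurry_bdarStep d rL rU φ0 φ α0 α).comp measurable_prodMk_left
    set A := ∑ j : Fin p, w ((j : ℕ) + 1) * |s.1 j| ^ r
    have hA : 0 ≤ A := Finset.sum_nonneg fun j _ =>
      mul_nonneg (hw0 _) (Real.rpow_nonneg (abs_nonneg _) _)
    set X := ∑ j, c j * |s.1 j| ^ r
    have hX : 0 ≤ X := Finset.sum_nonneg fun j _ =>
      mul_nonneg (hc0 _) (Real.rpow_nonneg (abs_nonneg _) _)
    rw [lintegral_map hVm.ennreal_ofReal hstep]
    simp only [bdarStep_eq_pushState, sum_mul_pushState hp d rL rU s _ hwp fun x => |x| ^ r,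
      hw_zero, one_mul]
    calc ∫⁻ ε, ENNReal.ofReal (|condMean φ0 φ (activeIndex d rL rU s) s.1
            + ε * √(condVar α0 α (activeIndex d rL rU s) s.1)| ^ r + A) ∂μ
        = ∫⁻ ε, ENNReal.ofReal (|condMean φ0 φ (activeIndex d rL rU s) s.1
            + ε * √(condVar α0 α (activeIndex d rL rU s) s.1)| ^ r) ∂μ + ENNReal.ofReal A := by
          simp only [ENNReal.ofReal_add (Real.rpow_nonneg (abs_nonneg _) _) hA]
          rw [lintegral_add_right _ measurable_const]
          simp
      _ ≤ ENNReal.ofReal (X + K) + ENNReal.ofReal A := by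
          gcongr
          exact hmom _ _
      _ = ENNReal.ofReal (X + K + A) := (ENNReal.ofReal_add (by positivity) hA).symm
      _ ≤ _ := by
          apply ENNReal.ofReal_le_ofReal
          have : X + A ≤ (1 - η) * ∑ j : Fin p, w j * |s.1 j| ^ r := by
            rw [← Finset.sum_add_distrib, Finset.mul_sum]
            refine Finset.sum_le_sum fun j _ => ?_
            have h1 : c j + w ((j : ℕ) + 1) ≤ (1 - η) * w j := by
              nlinarith [hw_succ j, hw1 j]
            have h2 : 0 ≤ |s.1 j| ^ r := Real.rpow_nonneg (abs_nonneg _) _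
            nlinarith
          linarith
  · have h1 : η * |s.1 j| ^ r ≤ R := by
      have h2 : w j * |s.1 j| ^ r ≤ ∑ j : Fin p, w j * |s.1 j| ^ r :=
        Finset.single_le_sum (f := fun j : Fin p => w j * |s.1 j| ^ r)
          (fun i _ => mul_nonneg (hw0 _) (Real.rpow_nonneg (abs_nonneg _) _)) (Finset.mem_univ j)
      have h3 : η ≤ w j := by
        rw [hw_succ]
        linarith [hc0 j, hw0 ((j : ℕ) + 1)]
      exact (mul_le_mul_of_nonneg_right h3 (Real.rpow_nonneg (abs_nonneg _) _)).trans
        (h2.trans hs)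
    have h2 : |s.1 j| ^ r ≤ R / η := by rwa [le_div_iff₀ hη0, mul_comm]
    exact (Real.le_rpow_inv_iff_of_pos (abs_nonneg _)
      ((Real.rpow_nonneg (abs_nonneg _) _).trans h2) hr).2 h2

end Lyapunov

section Moments

variable {p : ℕ}

lemma rpow_sum_le_sum_rpow {ι : Type*} (s : Finset ι) {x : ι → ℝ} (hx : ∀ i, 0 ≤ x i) {r : ℝ}
    (hr0 : 0 < r) (hr1 : r ≤ 1) : (∑ i ∈ s, x i) ^ r ≤ ∑ i ∈ s, x i ^ r := by
  classical
  induction s using Finset.induction_on with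
  | empty => simp [Real.zero_rpow hr0.ne']
  | insert i s hi ih =>
    rw [Finset.sum_insert hi, Finset.sum_insert hi]
    exact (Real.rpow_add_le_add_rpow (hx i) (Finset.sum_nonneg fun j _ => hx j) hr0.le hr1).trans
      (add_le_add le_rfl ih)

/-- A weighted Jensen inequality for an affine form, with an auxiliary weight `η` absorbing the
constant term. -/
lemma affine_rpow_le {ι : Type*} [Fintype ι] {b x : ι → ℝ} (hb : ∀ i, 0 ≤ b i)
    (hx : ∀ i, 0 ≤ x i) {F η r : ℝ} (hF : 0 ≤ F) (hη : 0 < η) (hr : 1 ≤ r) :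
    (F + ∑ i, b i * x i) ^ r
      ≤ (η + ∑ i, b i) ^ (r - 1) * (η * (F / η) ^ r + ∑ i, b i * x i ^ r) := by
  set W := η + ∑ i, b i with hW
  have hW0 : 0 < W := add_pos_of_pos_of_nonneg hη (Finset.sum_nonneg fun i _ => hb i)
  have key := Real.rpow_arith_mean_le_arith_mean_rpow (Finset.univ : Finset (Option ι))
    (fun o => (o.elim η b) / W) (fun o => o.elim (F / η) x)
    (by rintro (_ | i) -
        · exact div_nonneg hη.le hW0.le
        · exact div_nonneg (hb i) hW0.le)
    (by rw [Fintype.sum_option]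
        simp only [Option.elim, ← Finset.sum_div, ← add_div]
        exact div_self hW0.ne')
    (by rintro (_ | i) -
        · exact div_nonneg hF hη.le
        · exact hx i) hr
  rw [Fintype.sum_option, Fintype.sum_option] at key
  simp only [Option.elim, div_mul_eq_mul_div, ← Finset.sum_div, ← add_div,
    mul_div_cancel₀ _ hη.ne'] at key
  have hS : 0 ≤ F + ∑ i, b i * x i :=
    add_nonneg hF (Finset.sum_nonneg fun i _ => mul_nonneg (hb i) (hx i))
  rw [Real.div_rpow hS hW0.le, div_le_div_iff₀ (Real.rpow_pos_of_pos hW0 r) hW0] at key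
  rw [Real.rpow_sub_one hW0.ne', div_mul_eq_mul_div, le_div_iff₀ hW0, mul_comm (W ^ r)]
  exact key

lemma sq_rpow_half (x r : ℝ) : (x ^ 2) ^ (r / 2) = |x| ^ r := by
  rw [← sq_abs, ← Real.rpow_natCast, ← Real.rpow_mul (abs_nonneg x)]
  congr 1
  push_cast
  ring

lemma abs_add_rpow_add_abs_sub_rpow_le (x y : ℝ) {r : ℝ} (hr0 : 0 < r) (hr2 : r ≤ 2) :
    |x + y| ^ r + |x - y| ^ r ≤ 2 * (|x| ^ r + |y| ^ r) := by
  have h1 := (Real.concaveOn_rpow (p := r / 2) (by linarith) (by linarith)).2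
    (Set.mem_Ici.2 (sq_nonneg (x + y))) (Set.mem_Ici.2 (sq_nonneg (x - y)))
    (one_half_pos (α := ℝ)).le (one_half_pos (α := ℝ)).le (by norm_num)
  simp only [smul_eq_mul, sq_rpow_half] at h1
  have h2 : 1 / 2 * (x + y) ^ 2 + 1 / 2 * (x - y) ^ 2 = x ^ 2 + y ^ 2 := by ring
  rw [h2] at h1
  have h3 := Real.rpow_add_le_add_rpow (sq_nonneg x) (sq_nonneg y) (p := r / 2)
    (by linarith) (by linarith)
  simp only [sq_rpow_half] at h3
  linarith

lemma abs_condMean_le_affine {φ0 : Fin 2 → ℝ} {φ : Fin 2 → Fin p → ℝ} {b : Fin p → ℝ}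
    (hb : ∀ i j, |φ i j| ≤ b j) (i : Fin 2) (y : Fin p → ℝ) :
    |condMean φ0 φ i y| ≤ ∑ i, |φ0 i| + ∑ j, b j * |y j| := by
  refine (abs_add_le _ _).trans (add_le_add ?_ ((Finset.abs_sum_le_sum_abs _ _).trans ?_))
  · exact Finset.single_le_sum (f := fun i => |φ0 i|) (fun i _ => abs_nonneg _)
      (Finset.mem_univ i)
  · refine Finset.sum_le_sum fun j _ => ?_
    rw [abs_mul]
    exact mul_le_mul_of_nonneg_right (hb i j) (abs_nonneg _)

lemma condVar_le_affine {α0 : Fin 2 → ℝ} (hα0 : ∀ i, 0 < α0 i) {α : Fin 2 → Fin p → ℝ}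
    {a : Fin p → ℝ} (ha : ∀ i j, α i j ≤ a j) (i : Fin 2) (y : Fin p → ℝ) :
    condVar α0 α i y ≤ ∑ i, α0 i + ∑ j, a j * y j ^ 2 :=
  add_le_add (Finset.single_le_sum (f := α0) (fun i _ => (hα0 i).le) (Finset.mem_univ i))
    (Finset.sum_le_sum fun j _ => mul_le_mul_of_nonneg_right (ha i j) (sq_nonneg _))

lemma sqrt_condVar_rpow_le {α0 : Fin 2 → ℝ} (hα0 : ∀ i, 0 < α0 i) {α : Fin 2 → Fin p → ℝ}
    (hα : ∀ i j, 0 ≤ α i j) {a : Fin p → ℝ} (ha : ∀ i j, α i j ≤ a j) {r : ℝ} (hr0 : 0 < r)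
    (hr2 : r ≤ 2) (i : Fin 2) (y : Fin p → ℝ) :
    |√(condVar α0 α i y)| ^ r ≤ (∑ i, α0 i) ^ (r / 2) + ∑ j, a j ^ (r / 2) * |y j| ^ r := by
  have ha0 : ∀ j, 0 ≤ a j := fun j => (hα i j).trans (ha i j)
  have hv : 0 ≤ condVar α0 α i y := (hα0 i).le.trans (le_condVar hα i y)
  have hG : 0 ≤ ∑ i, α0 i := Finset.sum_nonneg fun i _ => (hα0 i).le
  have hr : 0 < r / 2 := by linarith
  have hr1 : r / 2 ≤ 1 := by linarith
  have hterm : ∀ j, 0 ≤ a j * y j ^ 2 := fun j => mul_nonneg (ha0 j) (sq_nonneg _)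
  rw [← sq_rpow_half, Real.sq_sqrt hv]
  calc condVar α0 α i y ^ (r / 2) ≤ (∑ i, α0 i + ∑ j, a j * y j ^ 2) ^ (r / 2) :=
        Real.rpow_le_rpow hv (condVar_le_affine hα0 ha i y) hr.le
    _ ≤ (∑ i, α0 i) ^ (r / 2) + (∑ j, a j * y j ^ 2) ^ (r / 2) :=
        Real.rpow_add_le_add_rpow hG (Finset.sum_nonneg fun j _ => hterm j) hr.le hr1
    _ ≤ (∑ i, α0 i) ^ (r / 2) + ∑ j, (a j * y j ^ 2) ^ (r / 2) :=
        add_le_add le_rfl (rpow_sum_le_sum_rpow _ hterm hr hr1)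
    _ = _ := by simp only [Real.mul_rpow (ha0 _) (sq_nonneg _), sq_rpow_half]

lemma lintegral_abs_add_mul_rpow_le {μ : Measure ℝ} [IsProbabilityMeasure μ] {r : ℝ} (hr0 : 0 < r)
    (hr1 : r ≤ 1) (hInt : Integrable (fun x => |x| ^ r) μ) (u v : ℝ) :
    ∫⁻ ε, ENNReal.ofReal (|u + ε * v| ^ r) ∂μ
      ≤ ENNReal.ofReal (|u| ^ r + |v| ^ r * ∫ x, |x| ^ r ∂μ) := by
  have hI : Integrable (fun ε => |u| ^ r + |v| ^ r * |ε| ^ r) μ :=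
    (integrable_const _).add (hInt.const_mul _)
  have h0 : ∀ ε : ℝ, 0 ≤ |u| ^ r + |v| ^ r * |ε| ^ r := fun ε => by positivity
  calc ∫⁻ ε, ENNReal.ofReal (|u + ε * v| ^ r) ∂μ
      ≤ ∫⁻ ε, ENNReal.ofReal (|u| ^ r + |v| ^ r * |ε| ^ r) ∂μ := by
        refine lintegral_mono fun ε => ENNReal.ofReal_le_ofReal ?_
        calc |u + ε * v| ^ r ≤ (|u| + |ε * v|) ^ r :=
              Real.rpow_le_rpow (abs_nonneg _) (abs_add_le _ _) hr0.le
          _ ≤ |u| ^ r + |ε * v| ^ r :=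
              Real.rpow_add_le_add_rpow (abs_nonneg _) (abs_nonneg _) hr0.le hr1
          _ = _ := by rw [abs_mul, Real.mul_rpow (abs_nonneg _) (abs_nonneg _), mul_comm (|ε| ^ r)]
    _ = _ := by
        rw [← ofReal_integral_eq_lintegral_ofReal hI (ae_of_all _ h0),
          integral_add (integrable_const _) (hInt.const_mul _), integral_const_mul]
        simp

lemma map_neg_withDensity {f : ℝ → ℝ≥0∞} (hf : ∀ x, f (-x) = f x) :
    (volume.withDensity f).map (fun x => -x) = volume.withDensity f := by
  ext A hA
  rw [Measure.map_apply measurable_neg hA, withDensity_apply _ (measurable_neg hA),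
    withDensity_apply _ hA]
  have h := (Measure.measurePreserving_neg (volume : Measure ℝ)).setLIntegral_comp_preimage_emb
    (MeasurableEquiv.neg ℝ).measurableEmbedding f A
  simpa only [hf] using h

lemma lintegral_abs_add_mul_rpow_le_of_map_neg {μ : Measure ℝ} [IsProbabilityMeasure μ] {r : ℝ}
    (hr0 : 0 < r) (hr2 : r ≤ 2) (hInt : Integrable (fun x => |x| ^ r) μ)
    (hμ : μ.map (fun x => -x) = μ) (u v : ℝ) :
    ∫⁻ ε, ENNReal.ofReal (|u + ε * v| ^ r) ∂μ
      ≤ ENNReal.ofReal (|u| ^ r + |v| ^ r * ∫ x, |x| ^ r ∂μ) := by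
  have hI : Integrable (fun ε => 2 * (|u| ^ r + |v| ^ r * |ε| ^ r)) μ :=
    ((integrable_const _).add (hInt.const_mul _)).const_mul 2
  have h0 : ∀ ε : ℝ, 0 ≤ 2 * (|u| ^ r + |v| ^ r * |ε| ^ r) := fun ε => by positivity
  have hm : Measurable fun ε : ℝ => ENNReal.ofReal (|u + ε * v| ^ r) := by fun_prop
  have hsymm : ∫⁻ ε, ENNReal.ofReal (|u + ε * v| ^ r) ∂μ
      = ∫⁻ ε, ENNReal.ofReal (|u - ε * v| ^ r) ∂μ := by
    conv_lhs => rw [← hμ, lintegral_map hm measurable_neg]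
    simp only [neg_mul, sub_eq_add_neg]
  have hM : 0 ≤ |u| ^ r + |v| ^ r * ∫ x, |x| ^ r ∂μ :=
    add_nonneg (by positivity) (mul_nonneg (by positivity)
      (integral_nonneg fun x => by positivity))
  have key : 2 * ∫⁻ ε, ENNReal.ofReal (|u + ε * v| ^ r) ∂μ
      ≤ 2 * ENNReal.ofReal (|u| ^ r + |v| ^ r * ∫ x, |x| ^ r ∂μ) := by
    calc 2 * ∫⁻ ε, ENNReal.ofReal (|u + ε * v| ^ r) ∂μ
        = ∫⁻ ε, (ENNReal.ofReal (|u + ε * v| ^ r) + ENNReal.ofReal (|u - ε * v| ^ r)) ∂μ := by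
          rw [lintegral_add_left hm, ← hsymm, two_mul]
      _ ≤ ∫⁻ ε, ENNReal.ofReal (2 * (|u| ^ r + |v| ^ r * |ε| ^ r)) ∂μ := by
          refine lintegral_mono fun ε => ?_
          rw [← ENNReal.ofReal_add (by positivity) (by positivity)]
          refine ENNReal.ofReal_le_ofReal ((abs_add_rpow_add_abs_sub_rpow_le _ _ hr0 hr2).trans ?_)
          rw [abs_mul, Real.mul_rpow (abs_nonneg _) (abs_nonneg _), mul_comm (|ε| ^ r)]
      _ = _ := by
          rw [← ofReal_integral_eq_lintegral_ofReal hI (ae_of_all _ h0), integral_const_mul,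
            integral_add (integrable_const _) (hInt.const_mul _), integral_const_mul,
            ENNReal.ofReal_mul two_pos.le]
          simp
  exact (ENNReal.mul_le_mul_iff_right two_ne_zero ENNReal.ofNat_ne_top).1 key

lemma lintegral_abs_add_mul_rpow_four_le {μ : Measure ℝ} [IsProbabilityMeasure μ]
    (hInt : Integrable (fun x => x ^ 4) μ) (h1 : ∫ x, x ∂μ = 0) (h3 : ∫ x, x ^ 3 ∂μ = 0)
    (u v : ℝ) :
    ∫⁻ ε, ENNReal.ofReal (|u + ε * v| ^ (4 : ℝ)) ∂μ
      ≤ ENNReal.ofReal ((1 + 3 * ∫ x, x ^ 2 ∂μ) * u ^ 4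
        + ((∫ x, x ^ 4 ∂μ) + 3 * ∫ x, x ^ 2 ∂μ) * v ^ 4) := by
  have hdom : Integrable (fun x : ℝ => 1 + x ^ 4) μ := (integrable_const _).add hInt
  have i1 : Integrable (fun x : ℝ => x) μ := hdom.mono' (by fun_prop) (ae_of_all _ fun x => by
    rw [Real.norm_eq_abs, abs_le]
    constructor <;> nlinarith [sq_nonneg (x ^ 2 - 1), sq_nonneg (x - 1), sq_nonneg (x + 1)])
  have i2 : Integrable (fun x : ℝ => x ^ 2) μ := hdom.mono' (by fun_prop) (ae_of_all _ fun x => by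
    rw [Real.norm_eq_abs, abs_le]
    constructor <;> nlinarith [sq_nonneg (x ^ 2 - 1), sq_nonneg x])
  have i3 : Integrable (fun x : ℝ => x ^ 3) μ := hdom.mono' (by fun_prop) (ae_of_all _ fun x => by
    rw [Real.norm_eq_abs, abs_le]
    constructor <;> nlinarith [sq_nonneg (x ^ 2 - 1), sq_nonneg (x * (x - 1)),
      sq_nonneg (x * (x + 1))])
  have hexp : ∀ ε : ℝ, |u + ε * v| ^ (4 : ℝ) = u ^ 4 + 4 * u ^ 3 * v * ε
      + 6 * u ^ 2 * v ^ 2 * ε ^ 2 + 4 * u * v ^ 3 * ε ^ 3 + v ^ 4 * ε ^ 4 := fun ε => by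
    rw [Real.rpow_ofNat, Even.pow_abs (by decide)]
    ring
  have j0 : Integrable (fun _ : ℝ => u ^ 4) μ := integrable_const _
  have j1 := j0.fun_add (i1.const_mul (4 * u ^ 3 * v))
  have j2 := j1.fun_add (i2.const_mul (6 * u ^ 2 * v ^ 2))
  have j3 := j2.fun_add (i3.const_mul (4 * u * v ^ 3))
  have j4 := j3.fun_add (hInt.const_mul (v ^ 4))
  have hval : ∫ ε, |u + ε * v| ^ (4 : ℝ) ∂μ
      = u ^ 4 + 6 * u ^ 2 * v ^ 2 * (∫ x, x ^ 2 ∂μ) + v ^ 4 * ∫ x, x ^ 4 ∂μ := by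
    simp only [hexp]
    rw [integral_add j3 (hInt.const_mul _), integral_add j2 (i3.const_mul _),
      integral_add j1 (i2.const_mul _), integral_add j0 (i1.const_mul _)]
    rw [integral_const_mul (4 * u ^ 3 * v) fun x => x]
    simp only [integral_const_mul, h1, h3]
    simp
  have hI : Integrable (fun ε => |u + ε * v| ^ (4 : ℝ)) μ := by
    simp only [hexp]
    exact j4
  rw [← ofReal_integral_eq_lintegral_ofReal hI (ae_of_all _ fun ε => by positivity), hval]
  refine ENNReal.ofReal_le_ofReal ?_
  have hm2 : 0 ≤ ∫ x, x ^ 2 ∂μ := integral_nonneg fun x => sq_nonneg x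
  nlinarith [mul_nonneg hm2 (sq_nonneg (u ^ 2 - v ^ 2))]

lemma exists_pos_lt_of_continuousAt {g : ℝ → ℝ} (hg : ContinuousAt g 0) {y : ℝ} (h : g 0 < y) :
    ∃ η > 0, g η < y := by
  have h1 : ∀ᶠ η in nhdsWithin (0 : ℝ) (Set.Ioi 0), g η < y :=
    nhdsWithin_le_nhds (hg.eventually_lt continuousAt_const h)
  obtain ⟨η, h2, h3⟩ := (h1.and self_mem_nhdsWithin).exists
  exact ⟨η, h3, h2⟩

end Moments

section MomentBounds

variable {p : ℕ} {φ0 : Fin 2 → ℝ} {φ : Fin 2 → Fin p → ℝ} {α0 : Fin 2 → ℝ}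
  {α : Fin 2 → Fin p → ℝ} {μ : Measure ℝ} [IsProbabilityMeasure μ] {a b : Fin p → ℝ} {r : ℝ}

/-- The moment bound for the BDAR recursion of exponent at most one. -/
lemma exists_moment_bound_of_le_one (hα0 : ∀ i, 0 < α0 i) (hα : ∀ i j, 0 ≤ α i j)
    (hb : ∀ i j, |φ i j| ≤ b j) (ha : ∀ i j, α i j ≤ a j) (hr0 : 0 < r) (hr1 : r ≤ 1)
    (hInt : Integrable (fun x => |x| ^ r) μ)
    (hlt : ∑ j, (b j ^ r + a j ^ (r / 2) * ∫ x, |x| ^ r ∂μ) < 1) :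
    ∃ c : Fin p → ℝ, (∀ j, 0 ≤ c j) ∧ ∑ j, c j < 1 ∧ ∃ K : ℝ, 0 < K ∧ ∀ i y,
      ∫⁻ ε, ENNReal.ofReal (|condMean φ0 φ i y + ε * √(condVar α0 α i y)| ^ r) ∂μ
        ≤ ENNReal.ofReal (∑ j, c j * |y j| ^ r + K) := by
  have hb0 : ∀ j, 0 ≤ b j := fun j => (abs_nonneg _).trans (hb 0 j)
  have ha0 : ∀ j, 0 ≤ a j := fun j => (hα 0 j).trans (ha 0 j)
  set m := ∫ x, |x| ^ r ∂μ
  have hm : 0 ≤ m := integral_nonneg fun x => by positivity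
  set F := ∑ i, |φ0 i|
  have hF : 0 ≤ F := Finset.sum_nonneg fun i _ => abs_nonneg _
  set G := ∑ i, α0 i
  have hG : 0 ≤ G := Finset.sum_nonneg fun i _ => (hα0 i).le
  refine ⟨_, fun j => ?_, hlt, F ^ r + G ^ (r / 2) * m + 1, by positivity, fun i y => ?_⟩
  · have := hb0 j
    have := ha0 j
    positivity
  refine (lintegral_abs_add_mul_rpow_le hr0 hr1 hInt _ _).trans (ENNReal.ofReal_le_ofReal ?_)
  have h1 : |condMean φ0 φ i y| ^ r ≤ F ^ r + ∑ j, b j ^ r * |y j| ^ r := by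
    have hterm : ∀ j, 0 ≤ b j * |y j| := fun j => mul_nonneg (hb0 j) (abs_nonneg _)
    calc |condMean φ0 φ i y| ^ r ≤ (F + ∑ j, b j * |y j|) ^ r :=
          Real.rpow_le_rpow (abs_nonneg _) (abs_condMean_le_affine hb i y) hr0.le
      _ ≤ F ^ r + (∑ j, b j * |y j|) ^ r :=
          Real.rpow_add_le_add_rpow hF (Finset.sum_nonneg fun j _ => hterm j) hr0.le hr1
      _ ≤ F ^ r + ∑ j, (b j * |y j|) ^ r :=
          add_le_add le_rfl (rpow_sum_le_sum_rpow _ hterm hr0 hr1)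
      _ = _ := by simp only [Real.mul_rpow (hb0 _) (abs_nonneg _)]
  have h2 := mul_le_mul_of_nonneg_right
    (sqrt_condVar_rpow_le hα0 hα ha hr0 (by linarith) i y) hm
  have h3 : ∑ j, (b j ^ r + a j ^ (r / 2) * m) * |y j| ^ r
      = ∑ j, b j ^ r * |y j| ^ r + (∑ j, a j ^ (r / 2) * |y j| ^ r) * m := by
    rw [Finset.sum_mul, ← Finset.sum_add_distrib]
    exact Finset.sum_congr rfl fun j _ => by ring
  rw [h3]
  linarith

/-- The moment bound for the BDAR recursion of exponent in `[1, 2]` with symmetric innovations. -/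
lemma exists_moment_bound_of_map_neg (hα0 : ∀ i, 0 < α0 i) (hα : ∀ i j, 0 ≤ α i j)
    (hb : ∀ i j, |φ i j| ≤ b j) (ha : ∀ i j, α i j ≤ a j) (hr1 : 1 ≤ r) (hr2 : r ≤ 2)
    (hInt : Integrable (fun x => |x| ^ r) μ) (hμ : μ.map (fun x => -x) = μ)
    (hlt : (∑ j, b j) ^ r + (∑ j, a j ^ (r / 2)) * (∫ x, |x| ^ r ∂μ) < 1) :
    ∃ c : Fin p → ℝ, (∀ j, 0 ≤ c j) ∧ ∑ j, c j < 1 ∧ ∃ K : ℝ, 0 < K ∧ ∀ i y,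
      ∫⁻ ε, ENNReal.ofReal (|condMean φ0 φ i y + ε * √(condVar α0 α i y)| ^ r) ∂μ
        ≤ ENNReal.ofReal (∑ j, c j * |y j| ^ r + K) := by
  have hr0 : 0 < r := by linarith
  have hb0 : ∀ j, 0 ≤ b j := fun j => (abs_nonneg _).trans (hb 0 j)
  have ha0 : ∀ j, 0 ≤ a j := fun j => (hα 0 j).trans (ha 0 j)
  set m := ∫ x, |x| ^ r ∂μ
  have hm : 0 ≤ m := integral_nonneg fun x => by positivity
  set F := ∑ i, |φ0 i|
  have hF : 0 ≤ F := Finset.sum_nonneg fun i _ => abs_nonneg _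
  set G := ∑ i, α0 i
  have hG : 0 ≤ G := Finset.sum_nonneg fun i _ => (hα0 i).le
  obtain ⟨η, hη, hηlt⟩ := exists_pos_lt_of_continuousAt
    (g := fun η => (η + ∑ j, b j) ^ r + (∑ j, a j ^ (r / 2)) * m)
    (((continuous_id.add continuous_const).continuousAt.rpow_const (Or.inr hr0.le)).add
      continuousAt_const) (by simpa using hlt)
  set W := η + ∑ j, b j
  have hB : 0 ≤ ∑ j, b j := Finset.sum_nonneg fun j _ => hb0 j
  have hW : 0 < W := add_pos_of_pos_of_nonneg hη hB
  refine ⟨fun j => W ^ (r - 1) * b j + a j ^ (r / 2) * m, fun j => ?_, ?_,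
    W ^ (r - 1) * (η * (F / η) ^ r) + G ^ (r / 2) * m + 1, by positivity, fun i y => ?_⟩
  · have := hb0 j
    have := ha0 j
    positivity
  · rw [Finset.sum_add_distrib, ← Finset.mul_sum, ← Finset.sum_mul]
    have h1 : W ^ (r - 1) * ∑ j, b j ≤ W ^ r := by
      calc W ^ (r - 1) * ∑ j, b j ≤ W ^ (r - 1) * W := by
            gcongr
            exact le_add_of_nonneg_left hη.le
        _ = W ^ r := by rw [Real.rpow_sub_one hW.ne', div_mul_cancel₀ _ hW.ne']
    linarith
  refine (lintegral_abs_add_mul_rpow_le_of_map_neg hr0 hr2 hInt hμ _ _).trans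
    (ENNReal.ofReal_le_ofReal ?_)
  have h1 : |condMean φ0 φ i y| ^ r
      ≤ W ^ (r - 1) * (η * (F / η) ^ r + ∑ j, b j * |y j| ^ r) :=
    (Real.rpow_le_rpow (abs_nonneg _) (abs_condMean_le_affine hb i y) hr0.le).trans
      (affine_rpow_le hb0 (fun j => abs_nonneg _) hF hη hr1)
  have h2 := mul_le_mul_of_nonneg_right (sqrt_condVar_rpow_le hα0 hα ha hr0 hr2 i y) hm
  have h3 : ∑ j, (W ^ (r - 1) * b j + a j ^ (r / 2) * m) * |y j| ^ r
      = W ^ (r - 1) * (∑ j, b j * |y j| ^ r) + (∑ j, a j ^ (r / 2) * |y j| ^ r) * m := by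
    rw [Finset.sum_mul, Finset.mul_sum, ← Finset.sum_add_distrib]
    exact Finset.sum_congr rfl fun j _ => by ring
  rw [h3]
  linarith

/-- The fourth moment bound for the BDAR recursion. -/
lemma exists_moment_bound_four (hα0 : ∀ i, 0 < α0 i) (hα : ∀ i j, 0 ≤ α i j)
    (hb : ∀ i j, |φ i j| ≤ b j) (ha : ∀ i j, α i j ≤ a j)
    (hInt : Integrable (fun x => x ^ 4) μ) (h1 : ∫ x, x ∂μ = 0) (h3 : ∫ x, x ^ 3 ∂μ = 0)
    (hlt : (1 + 3 * ∫ x, x ^ 2 ∂μ) * (∑ j, b j) ^ 4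
      + ((∫ x, x ^ 4 ∂μ) + 3 * ∫ x, x ^ 2 ∂μ) * (∑ j, a j) ^ 2 < 1) :
    ∃ c : Fin p → ℝ, (∀ j, 0 ≤ c j) ∧ ∑ j, c j < 1 ∧ ∃ K : ℝ, 0 < K ∧ ∀ i y,
      ∫⁻ ε, ENNReal.ofReal (|condMean φ0 φ i y + ε * √(condVar α0 α i y)| ^ (4 : ℝ)) ∂μ
        ≤ ENNReal.ofReal (∑ j, c j * |y j| ^ (4 : ℝ) + K) := by
  have hb0 : ∀ j, 0 ≤ b j := fun j => (abs_nonneg _).trans (hb 0 j)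
  have ha0 : ∀ j, 0 ≤ a j := fun j => (hα 0 j).trans (ha 0 j)
  have hm2 : 0 ≤ ∫ x, x ^ 2 ∂μ := integral_nonneg fun x => sq_nonneg x
  have hm4 : 0 ≤ ∫ x, x ^ 4 ∂μ := integral_nonneg fun x => by positivity
  have hmom := lintegral_abs_add_mul_rpow_four_le hInt h1 h3
  set M := 1 + 3 * ∫ x, x ^ 2 ∂μ
  set N := (∫ x, x ^ 4 ∂μ) + 3 * ∫ x, x ^ 2 ∂μ
  have hM : 0 ≤ M := by positivity
  have hN : 0 ≤ N := by positivity
  set F := ∑ i, |φ0 i|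
  have hF : 0 ≤ F := Finset.sum_nonneg fun i _ => abs_nonneg _
  set G := ∑ i, α0 i
  have hG : 0 ≤ G := Finset.sum_nonneg fun i _ => (hα0 i).le
  have hB : 0 ≤ ∑ j, b j := Finset.sum_nonneg fun j _ => hb0 j
  have hA : 0 ≤ ∑ j, a j := Finset.sum_nonneg fun j _ => ha0 j
  obtain ⟨η, hη, hηlt⟩ := exists_pos_lt_of_continuousAt
    (g := fun η => M * (η + ∑ j, b j) ^ 4 + N * (η + ∑ j, a j) ^ 2)
    (by fun_prop) (by simpa using hlt)
  have hBle : ∑ j, b j ≤ η + ∑ j, b j := le_add_of_nonneg_left hη.le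
  have hAle : ∑ j, a j ≤ η + ∑ j, a j := le_add_of_nonneg_left hη.le
  set W := η + ∑ j, b j
  set U := η + ∑ j, a j
  have hW : 0 ≤ W := hB.trans hBle
  have hU : 0 ≤ U := hA.trans hAle
  refine ⟨fun j => M * W ^ 3 * b j + N * U * a j, fun j => ?_, ?_,
    M * (W ^ 3 * (η * (F / η) ^ 4)) + N * (U * (η * (G / η) ^ 2)) + 1, by positivity,
    fun i y => ?_⟩
  · have := hb0 j
    have := ha0 j
    positivity
  · rw [Finset.sum_add_distrib, ← Finset.mul_sum, ← Finset.mul_sum]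
    calc M * W ^ 3 * ∑ j, b j + N * U * ∑ j, a j ≤ M * W ^ 3 * W + N * U * U := by gcongr
      _ = M * W ^ 4 + N * U ^ 2 := by ring
      _ < 1 := hηlt
  refine (hmom _ _).trans (ENNReal.ofReal_le_ofReal ?_)
  have hv : 0 ≤ condVar α0 α i y := (hα0 i).le.trans (le_condVar hα i y)
  have hy : ∀ j, |y j| ^ 4 = y j ^ 4 := fun j => Even.pow_abs (by decide) _
  have hu4 : condMean φ0 φ i y ^ 4 ≤ W ^ 3 * (η * (F / η) ^ 4 + ∑ j, b j * y j ^ 4) := by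
    have key := affine_rpow_le hb0 (fun j => abs_nonneg (y j)) hF hη (r := 4) (by norm_num)
    rw [show (4 : ℝ) - 1 = 3 by norm_num] at key
    simp only [Real.rpow_ofNat, hy] at key
    rw [← Even.pow_abs (by decide)]
    exact (pow_le_pow_left₀ (abs_nonneg _) (abs_condMean_le_affine hb i y) 4).trans key
  have hv4 : √(condVar α0 α i y) ^ 4 ≤ U * (η * (G / η) ^ 2 + ∑ j, a j * y j ^ 4) := by
    have key := affine_rpow_le ha0 (fun j => sq_nonneg (y j)) hG hη (r := 2) (by norm_num)
    rw [show (2 : ℝ) - 1 = 1 by norm_num] at key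
    simp only [Real.rpow_ofNat, Real.rpow_one, ← pow_mul] at key
    rw [show √(condVar α0 α i y) ^ 4 = condVar α0 α i y ^ 2 by
      rw [← Real.sq_sqrt hv, ← pow_mul, Real.sq_sqrt hv]]
    exact (pow_le_pow_left₀ hv (condVar_le_affine hα0 ha i y) 2).trans key
  have hsum : ∑ j, (M * W ^ 3 * b j + N * U * a j) * |y j| ^ (4 : ℝ)
      = M * (W ^ 3 * ∑ j, b j * y j ^ 4) + N * (U * ∑ j, a j * y j ^ 4) := by
    simp only [Real.rpow_ofNat, hy, Finset.mul_sum, ← Finset.sum_add_distrib]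
    exact Finset.sum_congr rfl fun j _ => by ring
  rw [hsum]
  linarith [mul_le_mul_of_nonneg_left hu4 hM, mul_le_mul_of_nonneg_left hv4 hN]

end MomentBounds

/-- Geometric ergodicity of the BDAR(p) Markov kernel: if the innovation law `μ` has
mean 0, variance 1 and an everywhere positive density `f` that is locally bounded away
from `0` with `sup_x (1+|x|) f x < ∞`, and one of the drift conditions (i)–(iii) holds,
then the kernel `κ` admits an invariant probability measure `π` and converges to it
geometrically fast in total variation from every starting state. -/
theorem bdar_geometric_ergodicity
    (p : ℕ) (hp : 1 ≤ p) (d : Fin p) (rL rU : ℝ) (hrLU : rL ≤ rU)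
    (φ0 : Fin 2 → ℝ) (φ : Fin 2 → Fin p → ℝ)
    (α0 : Fin 2 → ℝ) (α : Fin 2 → Fin p → ℝ)
    (hα0 : ∀ i, 0 < α0 i) (hα : ∀ i j, 0 ≤ α i j)
    (μ : Measure ℝ) [IsProbabilityMeasure μ]
    (f : ℝ → ℝ≥0∞) (hμf : μ = MeasureTheory.volume.withDensity f)
    (hfpos : ∀ x, 0 < f x)
    (hfloc : ∀ x : ℝ, ∃ c : ℝ≥0∞, 0 < c ∧ ∃ δ : ℝ, 0 < δ ∧ ∀ z, |z - x| < δ → c ≤ f z)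
    (hfbd : ∃ B : ℝ≥0∞, B ≠ ⊤ ∧ ∀ x, ENNReal.ofReal (1 + |x|) * f x ≤ B)
    (hmean : ∫ x, x ∂μ = 0) (hvar : ∫ x, x ^ 2 ∂μ = 1)
    (b : Fin p → ℝ) (hb : ∀ j, b j = max |φ 0 j| |φ 1 j|)
    (a : Fin p → ℝ) (ha : ∀ j, a j = max (α 0 j) (α 1 j))
    (hcond :
      -- (i) `r ∈ (0,1]`, `m_r < ∞`, `∑ⱼ (bⱼ^r + aⱼ^{r/2} m_r) < 1`
      (∃ r : ℝ, r ∈ Set.Ioc (0 : ℝ) 1 ∧ Integrable (fun x => |x| ^ r) μ ∧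
        ∑ j, (b j ^ r + a j ^ (r / 2) * ∫ x, |x| ^ r ∂μ) < 1) ∨
      -- (ii) `r ∈ (1,2]`, `m_r < ∞`, `f` symmetric, `(∑ⱼ bⱼ)^r + (∑ⱼ aⱼ^{r/2}) m_r < 1`
      (∃ r : ℝ, r ∈ Set.Ioc (1 : ℝ) 2 ∧ Integrable (fun x => |x| ^ r) μ ∧
        (∀ x, f (-x) = f x) ∧
        (∑ j, b j) ^ r + (∑ j, a j ^ (r / 2)) * (∫ x, |x| ^ r ∂μ) < 1) ∨
      -- (iii) `∫x³ dμ = 0`, `m₄ < ∞`, `(1+3m₂)(∑ⱼ bⱼ)⁴ + (m₄+3m₂)(∑ⱼ aⱼ)² < 1`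
      ((∫ x, x ^ 3 ∂μ) = 0 ∧ Integrable (fun x => x ^ 4) μ ∧
        (1 + 3 * ∫ x, x ^ 2 ∂μ) * (∑ j, b j) ^ 4
          + ((∫ x, x ^ 4 ∂μ) + 3 * ∫ x, x ^ 2 ∂μ) * (∑ j, a j) ^ 2 < 1))
    (κ : (Fin p → ℝ) × Bool → Measure ((Fin p → ℝ) × Bool))
    (hκ : ∀ s, κ s = μ.map (bdarStep p d rL rU φ0 φ α0 α s)) :
    ∃ π : Measure ((Fin p → ℝ) × Bool), IsProbabilityMeasure π ∧ π.bind κ = π ∧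
      ∃ ρ : ℝ, ρ ∈ Set.Ioo (0 : ℝ) 1 ∧
        ∀ s, ∃ C : ℝ, ∀ n : ℕ, 1 ≤ n → ∀ A : Set ((Fin p → ℝ) × Bool), MeasurableSet A →
          |((iterKernel κ n s) A).toReal - (π A).toReal| ≤ C * ρ ^ n := by
  have hb' : ∀ i j, |φ i j| ≤ b j := fun i j => by
    rw [hb]
    fin_cases i
    exacts [le_max_left _ _, le_max_right _ _]
  have ha' : ∀ i j, α i j ≤ a j := fun i j => by
    rw [ha]
    fin_cases i
    exacts [le_max_left _ _, le_max_right _ _]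
  obtain ⟨r, hr, c, hc0, hc1, K, hK, hmom⟩ : ∃ r : ℝ, 0 < r ∧ ∃ c : Fin p → ℝ,
      (∀ j, 0 ≤ c j) ∧ ∑ j, c j < 1 ∧ ∃ K : ℝ, 0 < K ∧ ∀ i y,
        ∫⁻ ε, ENNReal.ofReal (|condMean φ0 φ i y + ε * √(condVar α0 α i y)| ^ r) ∂μ
          ≤ ENNReal.ofReal (∑ j, c j * |y j| ^ r + K) := by
    rcases hcond with ⟨r, hr, hInt, hlt⟩ | ⟨r, hr, hInt, hsymm, hlt⟩ | ⟨h3, hInt, hlt⟩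
    · exact ⟨r, hr.1, exists_moment_bound_of_le_one hα0 hα hb' ha' hr.1 hr.2 hInt hlt⟩
    · refine ⟨r, one_pos.trans hr.1, exists_moment_bound_of_map_neg hα0 hα hb' ha' hr.1.le hr.2
        hInt ?_ hlt⟩
      rw [hμf]
      exact map_neg_withDensity hsymm
    · exact ⟨4, four_pos, exists_moment_bound_four hα0 hα hb' ha' hInt hmean h3 hlt⟩
  obtain ⟨V, hVm, hV0, ⟨γ, hγ0, hγ1, hdrift⟩, hsub⟩ :=
    exists_lyapunov hp d rL rU φ0 φ α0 α μ hr hc0 hc1 hK hmom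
  have hstep := measurable_uncurry_bdarStep d rL rU φ0 φ α0 α
  have hκm : Measurable κ := by
    rw [funext hκ]
    exact measurable_map_of_measurable_uncurry μ hstep
  have hprob : ∀ s, IsProbabilityMeasure (κ s) := fun s => by
    rw [hκ]
    exact Measure.isProbabilityMeasure_map (hstep.comp measurable_prodMk_left).aemeasurable
  obtain ⟨π, hπ, hinv, ρ, hρ, hconv⟩ := exists_invariant_of_drift_of_minorization hκm hprob hVm
    hV0 hγ0 hγ1 hK (fun s => by rw [hκ]; exact hdrift s) p.succ_ne_zero fun R => by
      obtain ⟨T, hT⟩ := hsub R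
      obtain ⟨e, he, ν, hν, hle⟩ := exists_bdar_minorization d rL rU φ0 φ hα0 hα hfloc hκm
        (fun s => hμf ▸ hκ s) T
      exact ⟨e, he, ν, hν, fun s hs => hle s (hT s hs)⟩
  refine ⟨π, hπ, hinv, ρ, hρ, fun s => ?_⟩
  obtain ⟨C, hC⟩ := hconv s
  exact ⟨C, fun n _ A hA => hC n A hA⟩
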